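/- arXiv:2009.07609 — 2 statements merged into one kernel-verified Lean document; each statement's English description precedes it below -/
import Mathlib

section
/- There exists an absolute constant C₁ ≥ 1 with the following property. Fix a real C ≥ 1 and a real c with 3/4 ≤ c ≤ 1. Let ζ₁, ζ₂ ∈ ℂ be roots of unity such that the pair (ζ₁, ζ₂) has order exactly N in the group ℂˣ × ℂˣ (i.e. N is the least positive integer with ζ₁^N = ζ₂^N = 1), where N ≥ 17. Then there exist a primitive N-th root of unity ζ, integers k₁, k₂ with gcd(k₁, k₂) = 1, an integer e ≥ 1, and complex numbers ξ₁, ξ₂ with ξ₁^e = ξ₂^e = 1, such that ζ₁ = ξ₁·ζ^{k₁}, ζ₂ = ξ₂·ζ^{k₂}, max(|k₁|, |k₂|) ≤ N^c / e, and either e ≤ C₁·C²·N^{1−c} or max(|k₁|, |k₂|) > C. -/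
/-- Lifting a residue class coprime to a divisor `M` of `N` to an integer coprime to `N`. -/
lemma aux_lift (N M : ℕ) (hN : N ≠ 0) (hM : M ∣ N) (s : ℤ) (hs : IsCoprime s (M : ℤ)) :
    ∃ t : ℤ, IsCoprime t (N : ℤ) ∧ (M : ℤ) ∣ t - s := by
  have : NeZero N := ⟨hN⟩
  have hu : IsUnit (s : ZMod M) := by
    obtain ⟨x, y, hxy⟩ := hs
    have := congrArg (Int.cast : ℤ → ZMod M) hxy
    push_cast at this
    simp only [ZMod.natCast_self, mul_zero, add_zero] at this
    exact IsUnit.of_mul_eq_one _ ((mul_comm _ _).trans this)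
  obtain ⟨u, hu'⟩ := ZMod.unitsMap_surjective hM hu.unit
  have h1 : ((u : ZMod N).val : ZMod M) = (s : ZMod M) := by
    have := congrArg (Units.val) hu'
    simp only [ZMod.unitsMap_val, IsUnit.unit_spec] at this
    rw [← this, ZMod.natCast_val]
  refine ⟨((u : ZMod N).val : ℤ), ?_, ?_⟩
  · exact Nat.isCoprime_iff_coprime.mpr (ZMod.val_coe_unit_coprime u)
  · rw [← ZMod.intCast_eq_intCast_iff_dvd_sub]
    push_cast
    exact h1.symm

/-- From a coprime vector and `e` annihilating its class, get the roots of unity. -/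
lemma aux_roots (N : ℕ) (hN : N ≠ 0) (ω : ℂ) (hω : IsPrimitiveRoot ω N) (a b : ℤ)
    (hprim : ∀ d : ℤ, d ∣ a → d ∣ b → d ∣ (N : ℤ) → IsUnit d)
    (k l : ℤ) (hkl : Int.gcd k l = 1) (e : ℕ) (he : 1 ≤ e)
    (hdvd : (N : ℤ) ∣ e * (a * l - b * k)) :
    ∃ ζ ξ₁ ξ₂ : ℂ, IsPrimitiveRoot ζ N ∧ ξ₁ ^ e = 1 ∧ ξ₂ ^ e = 1 ∧
      ω ^ a = ξ₁ * ζ ^ k ∧ ω ^ b = ξ₂ * ζ ^ l := by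
  have hω0 : ω ≠ 0 := hω.ne_zero hN
  obtain ⟨x, y, hxy⟩ := Int.isCoprime_iff_gcd_eq_one.mpr hkl
  obtain ⟨M, hM⟩ := Nat.gcd_dvd_left N e
  obtain ⟨e', he'⟩ := Nat.gcd_dvd_right N e
  have hg : 0 < Nat.gcd N e := Nat.gcd_pos_of_pos_right _ he
  have hcop : Nat.Coprime M e' := by
    have h1 := Nat.gcd_mul_left (Nat.gcd N e) M e'
    rw [← hM, ← he'] at h1
    exact Nat.eq_of_mul_eq_mul_left hg (by rw [mul_one]; exact h1.symm)
  have hMl : (M : ℤ) ∣ (a * l - b * k) := by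
    have h2 : ((Nat.gcd N e : ℕ) : ℤ) * M ∣ (Nat.gcd N e : ℕ) * (e' * (a * l - b * k)) := by
      rw [← mul_assoc]
      have e1 : ((Nat.gcd N e : ℕ) : ℤ) * M = N := by exact_mod_cast hM.symm
      have e2 : ((Nat.gcd N e : ℕ) : ℤ) * e' = e := by exact_mod_cast he'.symm
      rw [e1, e2]; exact hdvd
    have h3 := Int.dvd_of_mul_dvd_mul_left (by exact_mod_cast hg.ne') h2
    exact (Nat.isCoprime_iff_coprime.mpr hcop).dvd_of_dvd_mul_left h3
  have ha : (M : ℤ) ∣ a - (x * a + y * b) * k := by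
    have : a - (x * a + y * b) * k = y * (a * l - b * k) := by
      linear_combination (-a) * hxy
    rw [this]; exact hMl.mul_left _
  have hb : (M : ℤ) ∣ b - (x * a + y * b) * l := by
    have : b - (x * a + y * b) * l = (-x) * (a * l - b * k) := by
      linear_combination (-b) * hxy
    rw [this]; exact hMl.mul_left _
  have hMN : M ∣ N := ⟨_, by rw [mul_comm]; exact hM⟩
  have hs : IsCoprime (x * a + y * b) (M : ℤ) := by
    rw [Int.isCoprime_iff_gcd_eq_one]
    set d : ℤ := ((Int.gcd (x * a + y * b) M : ℕ) : ℤ) with hd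
    have d1 : d ∣ x * a + y * b := Int.gcd_dvd_left ..
    have d2 : d ∣ (M : ℤ) := Int.gcd_dvd_right ..
    have := hprim d ((dvd_sub_left (d1.mul_right k)).mp (d2.trans ha))
      ((dvd_sub_left (d1.mul_right l)).mp (d2.trans hb))
      (d2.trans (by exact_mod_cast hMN))
    rw [hd, Int.ofNat_isUnit] at this
    exact Nat.isUnit_iff.mp this
  obtain ⟨t, ht, htM⟩ := aux_lift N M hN hMN _ hs
  have hNe : (N : ℤ) ∣ M * e := by
    refine ⟨e', ?_⟩
    have : (N : ℤ) = (Nat.gcd N e : ℕ) * M := by exact_mod_cast hM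
    rw [this]
    have e2 : (e : ℤ) = ((Nat.gcd N e : ℕ) : ℤ) * e' := by exact_mod_cast he'
    linear_combination (M : ℤ) * e2
  have key : ∀ z m : ℤ, (M : ℤ) ∣ z - (x * a + y * b) * m →
      (ω ^ (z - t * m)) ^ e = 1 := by
    intro z m hz
    rw [← zpow_natCast, ← zpow_mul, hω.zpow_eq_one_iff_dvd]
    refine hNe.trans (mul_dvd_mul_right ?_ _)
    have : z - t * m = (z - (x * a + y * b) * m) - (t - (x * a + y * b)) * m := by ring
    rw [this]
    exact dvd_sub hz (htM.mul_right _)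
  refine ⟨ω ^ t, ω ^ (a - t * k), ω ^ (b - t * l), ?_, key _ _ ha, key _ _ hb, ?_, ?_⟩
  · exact hω.zpow_of_gcd_eq_one t (Int.isCoprime_iff_gcd_eq_one.mp ht)
  · rw [← zpow_mul, ← zpow_add₀ hω0]; congr 1; ring
  · rw [← zpow_mul, ← zpow_add₀ hω0]; congr 1; ring

/-- Thue's lemma. -/
lemma aux_thue (N : ℕ) (hN : N ≠ 0) (a b : ℤ) :
    ∃ x y : ℤ, (x ≠ 0 ∨ y ≠ 0) ∧ |x| ≤ Nat.sqrt N ∧ |y| ≤ Nat.sqrt N ∧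
      (N : ℤ) ∣ a * y - b * x := by
  have : NeZero N := ⟨hN⟩
  let R := Nat.sqrt N + 1
  let f : Fin R × Fin R → ZMod N := fun p => (a : ZMod N) * (p.2 : ℕ) - (b : ZMod N) * (p.1 : ℕ)
  have hc : Fintype.card (ZMod N) < Fintype.card (Fin R × Fin R) := by
    rw [ZMod.card, Fintype.card_prod, Fintype.card_fin]
    exact Nat.lt_succ_sqrt N
  obtain ⟨p, q, hpq, hf⟩ := Fintype.exists_ne_map_eq_of_card_lt f hc
  refine ⟨((p.1 : ℕ) : ℤ) - (q.1 : ℕ), ((p.2 : ℕ) : ℤ) - (q.2 : ℕ), ?_, ?_, ?_, ?_⟩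
  · by_contra! h
    apply hpq
    ext <;> omega
  · have := p.1.2; have := q.1.2; rw [abs_le]; constructor <;> omega
  · have := p.2.2; have := q.2.2; rw [abs_le]; constructor <;> omega
  · rw [← ZMod.intCast_zmod_eq_zero_iff_dvd]
    push_cast
    simp only [f] at hf
    linear_combination hf

/-- Content of a nonzero vector. -/
lemma aux_content (x y : ℤ) (h : x ≠ 0 ∨ y ≠ 0) :
    ∃ (g : ℕ) (k l : ℤ), 1 ≤ g ∧ Int.gcd k l = 1 ∧ x = g * k ∧ y = g * l := by
  have hg : 0 < Int.gcd x y := Int.gcd_pos_iff.mpr h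
  obtain ⟨k, hk⟩ := Int.gcd_dvd_left x y
  obtain ⟨l, hl⟩ := Int.gcd_dvd_right x y
  refine ⟨Int.gcd x y, k, l, hg, ?_, hk, hl⟩
  have := Int.gcd_mul_left (Int.gcd x y : ℤ) k l
  rw [← hk, ← hl, Int.natAbs_natCast] at this
  exact Nat.eq_of_mul_eq_mul_left hg (by rw [mul_one]; exact this.symm)

/-- Completion of a primitive vector to a basis with control. -/
lemma aux_compl (k l K : ℤ) (h : Int.gcd k l = 1) (hk : |k| ≤ K) (hl : |l| ≤ K) :
    ∃ u v : ℤ, k * v - l * u = 1 ∧ |u| ≤ 2 * K ∧ |v| ≤ 2 * K := by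
  obtain ⟨x, y, hxy⟩ := Int.isCoprime_iff_gcd_eq_one.mpr h
  by_cases hl0 : l = 0
  · subst hl0
    have hk1 : k * k = 1 := by
      have := Int.isUnit_iff.mp (IsUnit.of_mul_eq_one x (show k * x = 1 by linarith))
      rcases this with h | h <;> rw [h] <;> norm_num
    exact ⟨0, k, by linarith, by simp; linarith [abs_nonneg k], by linarith [abs_nonneg k]⟩
  · have hl1 : 1 ≤ |l| := Int.one_le_abs hl0
    have hm0 := Int.emod_nonneg x hl0
    have hm1 := Int.emod_lt_abs x hl0
    set r := x % l with hr
    have hx : x = r + l * (x / l) := by rw [hr, add_comm]; exact (Int.mul_ediv_add_emod x l).symm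
    set q := x / l
    refine ⟨-(y + k * q), r, by rw [hx] at hxy; linear_combination hxy, ?_, ?_⟩
    · have h1 : l * (-(y + k * q)) = k * r - 1 := by rw [hx] at hxy; linear_combination -hxy
      have h2 : |l| * |-(y + k * q)| ≤ |l| * (|k| + 1) := by
        rw [← abs_mul, h1]
        calc |k * r - 1| ≤ |k * r| + |1| := abs_sub _ _
          _ = |k| * r + 1 := by rw [abs_mul, abs_of_nonneg hm0]; simp
          _ ≤ _ := by nlinarith [abs_nonneg k]
      have := le_of_mul_le_mul_left h2 (by linarith)
      linarith
    · rw [abs_of_nonneg hm0]; linarith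

/-- A reduced basis of the lattice attached to the pair `(a, b)` modulo `N`. -/
lemma aux_basis (N : ℕ) (hN : N ≠ 0) (a b : ℤ)
    (hprim : ∀ d : ℤ, d ∣ a → d ∣ b → d ∣ (N : ℤ) → IsUnit d) :
    ∃ (e β : ℕ) (k l K u v α : ℤ), 1 ≤ e ∧ 1 ≤ β ∧ e * β = N ∧ Int.gcd k l = 1 ∧
      K = max |k| |l| ∧ e * K ≤ Nat.sqrt N ∧
      k * v - l * u = 1 ∧ |u| ≤ 2 * K ∧ |v| ≤ 2 * K ∧
      (N : ℤ) ∣ e * (a * l - b * k) ∧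
      (N : ℤ) ∣ a * (α * l + β * v) - b * (α * k + β * u) ∧
      0 ≤ α ∧ α < e ∧ (∀ d : ℤ, d ∣ e → d ∣ α → d ∣ β → IsUnit d) := by
  obtain ⟨x, y, hxy0, hx, hy, hdvd⟩ := aux_thue N hN a b
  obtain ⟨g, k, l, hg, hkl, rfl, rfl⟩ := aux_content x y hxy0
  obtain ⟨u, v, huv, hu, hv⟩ := aux_compl k l (max |k| |l|) hkl (le_max_left _ _) (le_max_right _ _)
  set f := a * l - b * k with hf
  set h := a * v - b * u with hh
  have hβ : 0 < Int.gcd f N := Int.gcd_pos_iff.mpr (Or.inr (by exact_mod_cast hN))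
  obtain ⟨f', hf'⟩ := Int.gcd_dvd_left f N
  obtain ⟨e, he⟩ : Int.gcd f N ∣ N := by exact_mod_cast Int.gcd_dvd_right f N
  set β := Int.gcd f N with hβd
  have he0 : 1 ≤ e := by
    rcases Nat.eq_zero_or_pos e with h0 | h0
    · rw [h0] at he; omega
    · exact h0
  have heZ : (N : ℤ) = β * e := by exact_mod_cast he
  have hβZ : (β : ℤ) ≠ 0 := by exact_mod_cast hβ.ne'
  have hcop : IsCoprime f' (e : ℤ) := by
    rw [Int.isCoprime_iff_gcd_eq_one]
    have h1 := Int.gcd_mul_left (β : ℤ) f' e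
    rw [← hf', ← heZ, Int.natAbs_natCast, ← hβd] at h1
    exact Nat.eq_of_mul_eq_mul_left hβ (by rw [mul_one]; exact h1.symm)
  have heg : (e : ℤ) ∣ g := by
    have h1 : (β : ℤ) * e ∣ β * (f' * g) := by
      rw [← heZ, ← mul_assoc, ← hf']
      convert hdvd using 1
      rw [hf]; ring
    exact hcop.symm.dvd_of_dvd_mul_left (Int.dvd_of_mul_dvd_mul_left hβZ h1)
  have heg' : (e : ℤ) ≤ g := Int.le_of_dvd (by exact_mod_cast hg) heg
  obtain ⟨p, q, hpq⟩ := hcop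
  have he1 : (0 : ℤ) < e := by exact_mod_cast he0
  set α := (-h * p) % (e : ℤ) with hα
  have hα1 : (e : ℤ) ∣ α * f' + h := by
    have h1 : (e : ℤ) ∣ -h * p - α := by
      rw [hα]; exact Int.dvd_self_sub_emod
    obtain ⟨j, hj⟩ := h1
    exact ⟨h * q - j * f', by linear_combination (-f') * hj - h * hpq⟩
  refine ⟨e, β, k, l, max |k| |l|, u, v, α, he0, hβ, by rw [he, mul_comm], hkl, rfl, ?_, huv,
    hu, hv, ?_, ?_, Int.emod_nonneg _ he1.ne', Int.emod_lt_of_pos _ he1, ?_⟩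
  · rw [abs_mul, Nat.abs_cast] at hx hy
    rcases max_choice |k| |l| with hm | hm <;> rw [hm]
    · nlinarith [abs_nonneg k]
    · nlinarith [abs_nonneg l]
  · exact ⟨f', by rw [heZ, ← hf, hf']; ring⟩
  · have : a * (α * l + β * v) - b * (α * k + β * u) = β * (α * f' + h) := by
      linear_combination α * hf' - α * hf - β * hh
    rw [this, heZ]
    exact mul_dvd_mul_left _ hα1
  · intro d d1 d2 d3
    have dh : d ∣ h := (dvd_add_right (d2.mul_right f')).mp (d1.trans hα1)
    have df : d ∣ f := by rw [hf']; exact d3.mul_right _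
    apply hprim d
    · have : a = k * h - u * f := by rw [hh, hf]; linear_combination (-a) * huv
      rw [this]; exact dvd_sub (dh.mul_left _) (df.mul_left _)
    · have : b = l * h - v * f := by rw [hh, hf]; linear_combination (-b) * huv
      rw [this]; exact dvd_sub (dh.mul_left _) (df.mul_left _)
    · rw [heZ]; exact d3.mul_right _

/-- The combinatorial core. -/
lemma aux_core (N : ℕ) (hN : N ≠ 0) (a b : ℤ)
    (hprim : ∀ d : ℤ, d ∣ a → d ∣ b → d ∣ (N : ℤ) → IsUnit d)
    (C X B : ℝ) (hC : 1 ≤ C) (h1 : (Nat.sqrt N : ℝ) ≤ X) (h2 : B < Nat.sqrt N → 4 * (Nat.sqrt N : ℝ) ≤ X)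
    (h3 : 100 * C ^ 2 * N ≤ B * X) (h4 : 2 * C ^ 2 ≤ B) :
    ∃ (k l : ℤ) (e : ℕ), Int.gcd k l = 1 ∧ 1 ≤ e ∧ (N : ℤ) ∣ e * (a * l - b * k) ∧
      e * |(k : ℝ)| ≤ X ∧ e * |(l : ℝ)| ≤ X ∧
      ((e : ℝ) ≤ B ∨ C < max |(k : ℝ)| |(l : ℝ)|) := by
  obtain ⟨e, β, k, l, K, u, v, α, he, hβ, heβ, hkl, hK, heK, huv, hu, hv, hd1, hd2, hα0, hα1,
    hcop⟩ := aux_basis N hN a b hprim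
  have hkK : |(k : ℝ)| ≤ K := by rw [hK]; exact_mod_cast le_max_left _ _
  have hlK : |(l : ℝ)| ≤ K := by rw [hK]; exact_mod_cast le_max_right _ _
  have hKmax : (K : ℝ) = max |(k : ℝ)| |(l : ℝ)| := by rw [hK]; push_cast; rfl
  have heKr : (e : ℝ) * K ≤ Nat.sqrt N := by exact_mod_cast heK
  have heR : (1 : ℝ) ≤ e := by exact_mod_cast he
  have hβR : (1 : ℝ) ≤ β := by exact_mod_cast hβ
  have hK1 : (1 : ℝ) ≤ K := by
    have : 1 ≤ K := by
      by_contra! hlt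
      have hk0 : |k| ≤ 0 := by have := le_max_left |k| |l|; omega
      have hl0 : |l| ≤ 0 := by have := le_max_right |k| |l|; omega
      rw [abs_nonpos_iff] at hk0 hl0
      rw [hk0, hl0] at hkl
      simp at hkl
    exact_mod_cast this
  by_cases hgood : (e : ℝ) ≤ B ∨ C < max |(k : ℝ)| |(l : ℝ)|
  · exact ⟨k, l, e, hkl, he, hd1, by nlinarith, by nlinarith, hgood⟩
  push Not at hgood
  obtain ⟨hBe, hKC⟩ := hgood
  rw [← hKmax] at hKC
  have hB0 : 0 < B := by nlinarith
  have hX4 : 4 * (Nat.sqrt N : ℝ) ≤ X := h2 (by nlinarith)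
  have hNr : (N : ℝ) = e * β := by exact_mod_cast heβ.symm
  have hβX : 100 * C ^ 2 * β ≤ X := by
    have : B * (100 * C ^ 2 * β) ≤ B * X := by
      refine le_trans ?_ h3
      rw [hNr]
      have : 0 ≤ 100 * C ^ 2 * β := by positivity
      nlinarith
    exact le_of_mul_le_mul_left this hB0
  have hβK : 100 * ((β : ℝ) * K) ≤ X := by
    have : (β : ℝ) * K ≤ C ^ 2 * β := by
      have hKC2 : (K : ℝ) ≤ C ^ 2 := by nlinarith
      rw [mul_comm]; gcongr
    linarith
  have hαR0 : (0 : ℝ) ≤ α := by exact_mod_cast hα0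
  have hαR1 : (α : ℝ) ≤ e := by exact_mod_cast hα1.le
  have huR : |(u : ℝ)| ≤ 2 * K := by exact_mod_cast hu
  have hvR : |(v : ℝ)| ≤ 2 * K := by exact_mod_cast hv
  have bnd : ∀ p q : ℤ, |(p : ℝ)| ≤ K → |(q : ℝ)| ≤ 2 * K →
      |((α * p + β * q : ℤ) : ℝ)| ≤ X / 2 := by
    intro p q hp hq
    push_cast
    calc |(α : ℝ) * p + β * q| ≤ |(α : ℝ) * p| + |(β : ℝ) * q| := abs_add_le _ _
      _ = α * |(p : ℝ)| + β * |(q : ℝ)| := by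
        rw [abs_mul, abs_mul, abs_of_nonneg hαR0, Nat.abs_cast]
      _ ≤ e * K + β * (2 * K) := by gcongr
      _ ≤ X / 2 := by linarith
  have b1 := bnd k u hkK huR
  have b2 := bnd l v hlK hvR
  have hβ0 : (β : ℤ) ≠ 0 := by exact_mod_cast (by omega : β ≠ 0)
  have hdet : k * (α * l + β * v) - l * (α * k + β * u) = β := by
    linear_combination (β : ℤ) * huv
  have hne : (α * k + β * u) ≠ 0 ∨ (α * l + β * v) ≠ 0 := by
    by_contra! hcon
    rw [hcon.1, hcon.2] at hdet
    apply hβ0; linarith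
  obtain ⟨g, k', l', hg, hkl', hgk, hgl⟩ := aux_content _ _ hne
  rw [hgk] at b1
  rw [hgl] at b2
  rw [hgk, hgl] at hdet hd2
  have hgR : (0 : ℝ) ≤ g := by positivity
  have b1' : g * |(k' : ℝ)| ≤ X / 2 := by
    push_cast at b1; rwa [abs_mul, Nat.abs_cast] at b1
  have b2' : g * |(l' : ℝ)| ≤ X / 2 := by
    push_cast at b2; rwa [abs_mul, Nat.abs_cast] at b2
  have hX0 : 0 ≤ X := le_trans (by positivity) h1
  by_cases hbig : C < max |(k' : ℝ)| |(l' : ℝ)|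
  · refine ⟨k', l', g, hkl', hg, ?_, by linarith, by linarith, Or.inr hbig⟩
    convert hd2 using 1; ring
  push Not at hbig
  have hk'C := (le_max_left _ _).trans hbig
  have hl'C := (le_max_right _ _).trans hbig
  set D := k * l' - l * k' with hD
  have hgD : g * D = β := by rw [← hdet, hD]; ring
  have hD0 : D ≠ 0 := by
    intro h0; rw [h0, mul_zero] at hgD; exact hβ0 hgD.symm
  have heg : IsCoprime (e : ℤ) (g : ℤ) := by
    rw [Int.isCoprime_iff_gcd_eq_one]
    set d : ℤ := ((Int.gcd (e : ℤ) g : ℕ) : ℤ) with hd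
    have d1 : d ∣ (e : ℤ) := Int.gcd_dvd_left ..
    have d2 : d ∣ (g : ℤ) := Int.gcd_dvd_right ..
    have hαe : α = g * (k' * v - l' * u) := by
      linear_combination (-α) * huv + v * hgk - u * hgl
    have := hcop d d1 (by rw [hαe]; exact d2.mul_right _) (by rw [← hgD]; exact d2.mul_right _)
    rw [hd, Int.ofNat_isUnit] at this
    exact Nat.isUnit_iff.mp this
  have he0 : (e : ℤ) ≠ 0 := by exact_mod_cast (by omega : e ≠ 0)
  have hne2 : (e * k + g * k') ≠ 0 ∨ (e * l + g * l') ≠ 0 := by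
    by_contra! hcon
    have : e * D = 0 := by rw [hD]; linear_combination l' * hcon.1 - k' * hcon.2
    exact (mul_ne_zero he0 hD0) this
  obtain ⟨t, k'', l'', ht, hkl'', htk, htl⟩ := aux_content _ _ hne2
  have htD : (t : ℤ) ∣ D := by
    have t1 : (t : ℤ) ∣ e * D :=
      ⟨k'' * l' - l'' * k', by rw [hD]; linear_combination l' * htk - k' * htl⟩
    have t2 : (t : ℤ) ∣ g * D :=
      ⟨k * l'' - l * k'', by rw [hD]; linear_combination k * htl - l * htk⟩
    obtain ⟨p, q, hpq⟩ := heg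
    have : D = p * (e * D) + q * (g * D) := by linear_combination (-D) * hpq
    rw [this]; exact dvd_add (t1.mul_left _) (t2.mul_left _)
  have htD' : (t : ℤ) ≤ |D| := Int.le_of_dvd (abs_pos.mpr hD0) ((dvd_abs _ _).mpr htD)
  have htR : (t : ℝ) ≤ |(D : ℝ)| := by exact_mod_cast htD'
  have hDC : |(D : ℝ)| ≤ 2 * C ^ 2 := by
    rw [hD]; push_cast
    calc |(k : ℝ) * l' - l * k'| ≤ |(k : ℝ) * l'| + |(l : ℝ) * k'| := abs_sub _ _
      _ = |(k : ℝ)| * |(l' : ℝ)| + |(l : ℝ)| * |(k' : ℝ)| := by rw [abs_mul, abs_mul]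
      _ ≤ C * C + C * C := by
        have := hkK.trans hKC
        have := hlK.trans hKC
        gcongr
      _ = 2 * C ^ 2 := by ring
  have bnd2 : ∀ p q r : ℤ, |(p : ℝ)| ≤ K → g * |(q : ℝ)| ≤ X / 2 → e * p + g * q = t * r →
      t * |(r : ℝ)| ≤ X := by
    intro p q r hp hq hr
    have hr' : (t : ℝ) * r = e * p + g * q := by exact_mod_cast hr.symm
    calc (t : ℝ) * |(r : ℝ)| = |(t : ℝ) * r| := by rw [abs_mul, Nat.abs_cast]
      _ ≤ |(e : ℝ) * p| + |(g : ℝ) * q| := by rw [hr']; exact abs_add_le _ _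
      _ = e * |(p : ℝ)| + g * |(q : ℝ)| := by rw [abs_mul, abs_mul, Nat.abs_cast, Nat.abs_cast]
      _ ≤ e * K + X / 2 := by gcongr
      _ ≤ X := by linarith
  refine ⟨k'', l'', t, hkl'', ht, ?_, bnd2 _ _ _ hkK b1' htk, bnd2 _ _ _ hlK b2' htl,
    Or.inl (by linarith)⟩
  have : (t : ℤ) * (a * l'' - b * k'') = e * (a * l - b * k) + (a * (g * l') - b * (g * k')) := by
    linear_combination b * htk - a * htl
  rw [this]
  exact dvd_add hd1 hd2

theorem stmt8 :
    ∃ C₁ : ℝ, 1 ≤ C₁ ∧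
      ∀ (C : ℝ), 1 ≤ C → ∀ (c : ℝ), 3 / 4 ≤ c → c ≤ 1 →
        ∀ (N : ℕ), 17 ≤ N → ∀ ζ₁ ζ₂ : ℂ,
          ζ₁ ^ N = 1 → ζ₂ ^ N = 1 →
          (∀ m : ℕ, 0 < m → m < N → ¬ (ζ₁ ^ m = 1 ∧ ζ₂ ^ m = 1)) →
          ∃ (ζ : ℂ) (k₁ k₂ : ℤ) (e : ℕ) (ξ₁ ξ₂ : ℂ),
            IsPrimitiveRoot ζ N ∧ Int.gcd k₁ k₂ = 1 ∧ 1 ≤ e ∧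
            ξ₁ ^ e = 1 ∧ ξ₂ ^ e = 1 ∧
            ζ₁ = ξ₁ * ζ ^ k₁ ∧ ζ₂ = ξ₂ * ζ ^ k₂ ∧
            max (|k₁| : ℝ) (|k₂| : ℝ) ≤ (N : ℝ) ^ c / e ∧
            ((e : ℝ) ≤ C₁ * C ^ 2 * (N : ℝ) ^ (1 - c) ∨
              C < max (|k₁| : ℝ) (|k₂| : ℝ)) := by
  refine ⟨100, by norm_num, ?_⟩
  intro C hC c hc hc1 N hN17 ζ₁ ζ₂ hz1 hz2 hord
  have hN : N ≠ 0 := by omega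
  have : NeZero N := ⟨hN⟩
  have hω := Complex.isPrimitiveRoot_exp N hN
  set ω := Complex.exp (2 * Real.pi * Complex.I / N)
  obtain ⟨a, -, rfl⟩ := hω.eq_pow_of_pow_eq_one hz1
  obtain ⟨b, -, rfl⟩ := hω.eq_pow_of_pow_eq_one hz2
  have hprim : ∀ d : ℤ, d ∣ (a : ℤ) → d ∣ (b : ℤ) → d ∣ (N : ℤ) → IsUnit d := by
    intro d da db dN
    rw [← Int.natAbs_dvd, Int.natCast_dvd_natCast] at da db dN
    rw [Int.isUnit_iff_natAbs_eq]
    obtain ⟨m, hm⟩ := dN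
    by_contra hd1
    have hd0 : d.natAbs ≠ 0 := by
      intro h0; rw [h0, zero_mul] at hm; exact hN hm
    have hm0 : 0 < m := by
      rcases Nat.eq_zero_or_pos m with h0 | h0
      · rw [h0, mul_zero] at hm; exact absurd hm hN
      · exact h0
    have hd2 : 2 ≤ d.natAbs := by omega
    refine hord m hm0 (by rw [hm]; nlinarith) ⟨?_, ?_⟩
    · rw [← pow_mul, hω.pow_eq_one_iff_dvd, hm]; exact mul_dvd_mul_right da m
    · rw [← pow_mul, hω.pow_eq_one_iff_dvd, hm]; exact mul_dvd_mul_right db m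
  have hN1 : (1 : ℝ) ≤ N := by exact_mod_cast (by omega : 1 ≤ N)
  have hN0 : (0 : ℝ) < N := by linarith
  have hsq : (Nat.sqrt N : ℝ) ≤ (N : ℝ) ^ (1 / 2 : ℝ) := by
    rw [← Real.sqrt_eq_rpow]; exact Real.nat_sqrt_le_real_sqrt
  have hY1 : 1 ≤ (N : ℝ) ^ (1 - c) := Real.one_le_rpow hN1 (by linarith)
  have hX : (N : ℝ) ^ (3 / 4 : ℝ) ≤ (N : ℝ) ^ c := Real.rpow_le_rpow_of_exponent_le hN1 hc
  have hq1 : 1 ≤ (N : ℝ) ^ (1 / 4 : ℝ) := Real.one_le_rpow hN1 (by norm_num)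
  have e2 : (N : ℝ) ^ (1 / 2 : ℝ) = (N : ℝ) ^ (1 / 4 : ℝ) * (N : ℝ) ^ (1 / 4 : ℝ) := by
    rw [← Real.rpow_add hN0]; norm_num
  have e3 : (N : ℝ) ^ (3 / 4 : ℝ) = (N : ℝ) ^ (1 / 2 : ℝ) * (N : ℝ) ^ (1 / 4 : ℝ) := by
    rw [← Real.rpow_add hN0]; norm_num
  have hC2 : 1 ≤ C ^ 2 := one_le_pow₀ hC
  have hB : C ^ 2 ≤ C ^ 2 * (N : ℝ) ^ (1 - c) := le_mul_of_one_le_right (by positivity) hY1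
  obtain ⟨k, l, e, hkl, he, hdvd, hk, hl, hor⟩ := aux_core N hN a b hprim C ((N : ℝ) ^ c)
    (100 * C ^ 2 * (N : ℝ) ^ (1 - c)) hC (by nlinarith) (by
      intro hlt
      have h100 : 100 < (N : ℝ) ^ (1 / 2 : ℝ) := by linarith
      have h4 : 4 ≤ (N : ℝ) ^ (1 / 4 : ℝ) := by
        by_contra! hh
        nlinarith
      nlinarith) (by
      rw [mul_assoc (100 * C ^ 2), ← Real.rpow_add hN0]; simp) (by linarith)
  obtain ⟨ζ, ξ₁, ξ₂, hζ, hx1, hx2, hz1', hz2'⟩ := aux_roots N hN ω hω a b hprim k l hkl e he hdvd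
  rw [zpow_natCast] at hz1' hz2'
  refine ⟨ζ, k, l, e, ξ₁, ξ₂, hζ, hkl, he, hx1, hx2, hz1', hz2', ?_, hor⟩
  have heR : (0 : ℝ) < e := by exact_mod_cast he
  rw [max_le_iff, le_div_iff₀ heR, le_div_iff₀ heR]
  exact ⟨by linarith, by linarith⟩
end

section
/- Let 𝕃 be an algebraically closed field of characteristic 0 that is complete with respect to a nontrivial non-archimedean absolute value |·|. Let f ∈ 𝕃[X] be a monic polynomial of degree d ≥ 2 all of whose coefficients are algebraic over ℚ. Let 0 < R ≤ 1 and let Ψ be an analytic function on Δ_R* = {z ∈ 𝕃 : 0 < |z| < R} such that z·Ψ(z) extends to an analytic function on {z : |z| < R} with value 1 at 0, Ψ(z^d) = f(Ψ(z)) for all z ∈ Δ_R*, and |Ψ(z)| = |z|^{−1} for all z ∈ Δ_R*. Let P ∈ 𝕃[X,Y] be a nonzero irreducible polynomial all of whose coefficients are algebraic over ℚ, let ζ₁, ζ₂ ∈ 𝕃 be roots of unity, let (k₁, k₂) ∈ ℤ² \ {(0,0)}, and let a ∈ 𝕃 be transcendental over ℚ with 0 < |a| < R^d. If P(1/Ψ(ζ₁·a·x^{k₁}),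 1/Ψ(ζ₂·a·x^{k₂})) = 0 for every x ∈ 𝕃 with 0 < |a·x^{k₁}| < R and 0 < |a·x^{k₂}| < R, then k₁·k₂·(k₁ − k₂) = 0. -/
lemma hasSum_norm_le_of {𝕃 : Type*} [NontriviallyNormedField 𝕃] [CompleteSpace 𝕃]
    [IsUltrametricDist 𝕃] {g : ℕ → 𝕃} {C : ℝ} (hC : 0 ≤ C) (h : ∀ n, ‖g n‖ ≤ C) :
    ‖∑' n, g n‖ ≤ C :=
  IsUltrametricDist.norm_tsum_le_of_forall_le_of_nonneg hC h

lemma tsum_norm_lt_of {𝕃 : Type*} [NontriviallyNormedField 𝕃] [CompleteSpace 𝕃]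
    [IsUltrametricDist 𝕃] {g : ℕ → 𝕃} {C : ℝ} (hC : 0 < C) (h : ∀ n, ‖g n‖ < C)
    (hg : Filter.Tendsto g Filter.atTop (nhds 0)) :
    ‖∑' n, g n‖ < C := by
  have h1 : ∀ᶠ n in Filter.atTop, ‖g n‖ < C / 2 := by
    have := hg.norm
    rw [norm_zero] at this
    exact this.eventually_lt_const (by positivity)
  obtain ⟨N, hN⟩ := Filter.eventually_atTop.1 h1
  obtain ⟨M, hM, hM2⟩ : ∃ M, (M < C ∧ 0 ≤ M) ∧ ∀ n < N, ‖g n‖ ≤ M := by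
    clear hN
    induction N with
    | zero => exact ⟨0, ⟨hC, le_rfl⟩, by simp⟩
    | succ N ih =>
      obtain ⟨M, hM, hM2⟩ := ih
      refine ⟨max M ‖g N‖, ⟨max_lt hM.1 (h N), le_max_of_le_left hM.2⟩, fun n hn => ?_⟩
      rcases Nat.lt_succ_iff_lt_or_eq.1 hn with h | h
      · exact (hM2 n h).trans (le_max_left _ _)
      · subst h; exact le_max_right _ _
  refine lt_of_le_of_lt (hasSum_norm_le_of (C := max M (C / 2)) (le_max_of_le_left hM.2) ?_)
    (max_lt hM.1 (by linarith))
  intro n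
  rcases lt_or_ge n N with h | h
  · exact (hM2 n h).trans (le_max_left _ _)
  · exact (hN n h).le.trans (le_max_right _ _)

lemma summable_of_tends {𝕃 : Type*} [NontriviallyNormedField 𝕃] [CompleteSpace 𝕃]
    [IsUltrametricDist 𝕃] {g : ℕ → 𝕃}
    (hg : Filter.Tendsto g Filter.atTop (nhds 0)) : Summable g := by
  apply NonarchimedeanAddGroup.summable_of_tendsto_cofinite_zero
  rwa [Nat.cofinite_eq_atTop]

lemma tends_mul_of_le_one {𝕃 : Type*} [NontriviallyNormedField 𝕃]
    {g t : ℕ → 𝕃} (hg : Filter.Tendsto g Filter.atTop (nhds 0)) (ht : ∀ n, ‖t n‖ ≤ 1) :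
    Filter.Tendsto (fun n => g n * t n) Filter.atTop (nhds 0) := by
  refine squeeze_zero_norm (fun n => ?_) (tendsto_zero_iff_norm_tendsto_zero.1 hg)
  rw [norm_mul]
  exact mul_le_of_le_one_right (norm_nonneg _) (ht n)

lemma strassmann_aux {𝕃 : Type*} [NontriviallyNormedField 𝕃] [CompleteSpace 𝕃]
    [IsUltrametricDist 𝕃] (N : ℕ) : ∀ (B : ℕ → 𝕃),
    Filter.Tendsto B Filter.atTop (nhds 0) → B N ≠ 0 → (∀ n, ‖B n‖ ≤ ‖B N‖) →
    (∀ n, N < n → ‖B n‖ < ‖B N‖) →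
    {t : 𝕃 | ‖t‖ ≤ 1 ∧ ∑' n, B n * t ^ n = 0}.Finite := by
  induction N with
  | zero =>
    intro B hB h0 hle hlt
    convert Set.finite_empty
    ext t
    simp only [Set.mem_ofPred_eq, Set.mem_empty_iff_false, iff_false, not_and]
    intro ht hs
    have htn : ∀ n : ℕ, ‖t ^ n‖ ≤ 1 := fun n => by
      rw [norm_pow]; exact pow_le_one₀ (norm_nonneg _) ht
    have hT := tends_mul_of_le_one hB htn
    rw [(summable_of_tends hT).tsum_eq_zero_add] at hs
    have h1 : ‖∑' n, B (n + 1) * t ^ (n + 1)‖ < ‖B 0‖ := by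
      apply tsum_norm_lt_of (norm_pos_iff.2 h0)
      · intro n
        rw [norm_mul]
        exact (mul_le_of_le_one_right (norm_nonneg _) (htn _)).trans_lt (hlt _ (Nat.succ_pos n))
      · exact hT.comp (Filter.tendsto_add_atTop_nat 1)
    have h2 : B 0 = - ∑' n, B (n + 1) * t ^ (n + 1) := by
      rw [pow_zero, mul_one] at hs
      exact eq_neg_of_add_eq_zero_left hs
    rw [h2, norm_neg] at h1
    exact lt_irrefl _ h1
  | succ N ih =>
    intro B hB h0 hle hlt
    by_cases hz : ∃ α : 𝕃, ‖α‖ ≤ 1 ∧ ∑' n, B n * α ^ n = 0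
    swap
    · convert Set.finite_empty
      ext t
      simp only [Set.mem_ofPred_eq, Set.mem_empty_iff_false, iff_false]
      exact fun h => hz ⟨t, h⟩
    obtain ⟨α, hα, hαz⟩ := hz
    have hαn : ∀ n : ℕ, ‖α ^ n‖ ≤ 1 := fun n => by
      rw [norm_pow]; exact pow_le_one₀ (norm_nonneg _) hα
    have hM : 0 < ‖B (N + 1)‖ := norm_pos_iff.2 h0
    have hT : ∀ j, Filter.Tendsto (fun i => B (j + 1 + i) * α ^ i) Filter.atTop (nhds 0) :=
      fun j => tends_mul_of_le_one (hB.comp (Filter.tendsto_add_atTop_nat (j + 1)|>.congr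
        (fun n => by omega))) hαn
    set G : ℕ → 𝕃 := fun j => ∑' i, B (j + 1 + i) * α ^ i with hG
    have hrec : ∀ j, G j = B (j + 1) + α * G (j + 1) := by
      intro j
      simp only [hG]
      rw [(summable_of_tends (hT j)).tsum_eq_zero_add, pow_zero, mul_one, add_zero,
        ← tsum_mul_left]
      congr 1
      apply tsum_congr
      intro i
      rw [pow_succ', show j + 1 + (i + 1) = j + 1 + 1 + i by ring]
      ring
    have hbd : ∀ j C, 0 ≤ C → (∀ n, j < n → ‖B n‖ ≤ C) → ‖G j‖ ≤ C := by
      intro j C hC h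
      apply hasSum_norm_le_of hC
      intro i
      rw [norm_mul]
      exact (mul_le_of_le_one_right (norm_nonneg _) (hαn _)).trans (h _ (by omega))
    have hbd2 : ∀ j, N < j → ‖G j‖ < ‖B (N + 1)‖ := by
      intro j hj
      apply tsum_norm_lt_of hM
      · intro i
        rw [norm_mul]
        exact (mul_le_of_le_one_right (norm_nonneg _) (hαn _)).trans_lt (hlt _ (by omega))
      · exact hT j
    have hGN : ‖G N‖ = ‖B (N + 1)‖ := by
      rw [hrec N]
      have h1 : ‖α * G (N + 1)‖ < ‖B (N + 1)‖ := by
        rw [norm_mul]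
        exact (mul_le_of_le_one_left (norm_nonneg _) hα).trans_lt (hbd2 _ (Nat.lt_succ_self N))
      rw [IsUltrametricDist.norm_add_eq_max_of_norm_ne_norm h1.ne', max_eq_left h1.le]
    have hGt : Filter.Tendsto G Filter.atTop (nhds 0) := by
      rw [NormedAddCommGroup.tendsto_atTop']
      intro ε hε
      rw [NormedAddCommGroup.tendsto_atTop'] at hB
      obtain ⟨n0, hn0⟩ := hB (ε / 2) (by positivity)
      refine ⟨n0, fun n hn => ?_⟩
      rw [sub_zero]
      refine (hbd n (ε / 2) (by positivity) fun m hm => ?_).trans_lt (by linarith)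
      simpa using (hn0 m (by omega)).le
    have hfin := ih G hGt (norm_pos_iff.1 (by rw [hGN]; exact hM))
      (fun n => by rw [hGN]; exact hbd n _ hM.le fun m _ => hle m)
      (fun n hn => by rw [hGN]; exact hbd2 n hn)
    refine (hfin.insert α).subset ?_
    rintro t ⟨ht, htz⟩
    by_cases hta : t = α
    · exact Or.inl hta
    refine Or.inr ⟨ht, ?_⟩
    have htn : ∀ n : ℕ, ‖t ^ n‖ ≤ 1 := fun n => by
      rw [norm_pow]; exact pow_le_one₀ (norm_nonneg _) ht
    have hGs := summable_of_tends (tends_mul_of_le_one hGt htn)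
    have hBs := summable_of_tends (tends_mul_of_le_one hB htn)
    have hB0 : B 0 = - (α * G 0) := by
      have := (summable_of_tends (tends_mul_of_le_one hB hαn)).tsum_eq_zero_add
      rw [hαz, pow_zero, mul_one] at this
      rw [eq_comm] at this
      rw [eq_neg_of_add_eq_zero_left this]
      simp only [hG]
      rw [← tsum_mul_left]
      congr 1
      apply tsum_congr
      intro i
      rw [pow_succ', show 0 + 1 + i = i + 1 by ring]
      ring
    have key : (t - α) * ∑' n, G n * t ^ n = 0 := by
      rw [hBs.tsum_eq_zero_add, pow_zero, mul_one, hB0] at htz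
      have e1 : ∑' n, B (n + 1) * t ^ (n + 1)
          = t * ∑' n, G n * t ^ n - α * ∑' n, G (n + 1) * t ^ (n + 1) := by
        rw [← tsum_mul_left, ← tsum_mul_left, ← Summable.tsum_sub (hGs.mul_left t)
          (((summable_nat_add_iff 1).2 hGs).mul_left α)]
        apply tsum_congr
        intro n
        rw [hrec n]; ring
      rw [e1] at htz
      have e2 := hGs.tsum_eq_zero_add
      rw [pow_zero, mul_one] at e2
      linear_combination htz - α * e2
    exact (mul_eq_zero.1 key).resolve_left (sub_ne_zero.2 hta)

lemma strassmann {𝕃 : Type*} [NontriviallyNormedField 𝕃] [CompleteSpace 𝕃]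
    [IsUltrametricDist 𝕃] (B : ℕ → 𝕃) (hB : Filter.Tendsto B Filter.atTop (nhds 0))
    (hinf : {t : 𝕃 | ‖t‖ ≤ 1 ∧ ∑' n, B n * t ^ n = 0}.Infinite) : ∀ n, B n = 0 := by
  by_contra hne
  push Not at hne
  obtain ⟨n1, hn1⟩ := hne
  apply hinf
  have hev : ∀ᶠ n in Filter.atTop, ‖B n‖ < ‖B n1‖ := by
    have := hB.norm
    rw [norm_zero] at this
    exact this.eventually_lt_const (norm_pos_iff.2 hn1)
  obtain ⟨N0, hN0⟩ := Filter.eventually_atTop.1 hev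
  -- maximum over range
  obtain ⟨m, hm, hmax⟩ := Finset.exists_max_image (Finset.range (N0 + n1 + 1)) (fun n => ‖B n‖)
    ⟨n1, by simp⟩
  have hmall : ∀ n, ‖B n‖ ≤ ‖B m‖ := by
    intro n
    by_cases h : n < N0 + n1 + 1
    · exact hmax n (by simpa using h)
    · exact (hN0 n (by omega)).le.trans (hmax n1 (by simp))
  have hex : ∃ N, ∀ n, N < n → ‖B n‖ < ‖B m‖ :=
    ⟨N0, fun n hn => (hN0 n hn.le).trans_le (hmall n1)⟩
  classical
  have hspec := Nat.find_spec hex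
  have hmin := fun k => Nat.find_min hex (m := k)
  set N := Nat.find hex
  have hNm : ‖B N‖ = ‖B m‖ := by
    apply le_antisymm (hmall N)
    by_contra hlt
    push Not at hlt
    rcases Nat.eq_zero_or_pos N with h0 | hpos
    · rcases Nat.eq_zero_or_pos m with hm0 | hmp
      · rw [h0, hm0] at hlt; exact lt_irrefl _ hlt
      · exact lt_irrefl _ (hspec m (by omega))
    · apply hmin (N - 1) (by omega)
      intro n hn
      rcases eq_or_lt_of_le (show N ≤ n by omega) with h | h
      · rw [← h]; exact hlt
      · exact hspec n h
  have hpos : 0 < ‖B N‖ := by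
    rw [hNm]; exact (norm_pos_iff.2 hn1).trans_le (hmall n1)
  exact strassmann_aux N B hB (norm_pos_iff.1 hpos) (fun n => by rw [hNm]; exact hmall n)
    (fun n hn => by rw [hNm]; exact hspec n hn)

/-- `F` is given on the closed unit disc by an absolutely convergent power series. -/
def GoodOnDisc {𝕃 : Type*} [NontriviallyNormedField 𝕃] (F : 𝕃 → 𝕃) : Prop :=
  ∃ A : ℕ → 𝕃, Summable (fun n => ‖A n‖) ∧ ∀ t, ‖t‖ ≤ 1 → HasSum (fun n => A n * t ^ n) (F t)

lemma GoodOnDisc.eq_zero {𝕃 : Type*} [NontriviallyNormedField 𝕃] [CompleteSpace 𝕃]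
    [IsUltrametricDist 𝕃] {F : 𝕃 → 𝕃} (hF : GoodOnDisc F)
    (hinf : {t : 𝕃 | ‖t‖ ≤ 1 ∧ F t = 0}.Infinite) : ∀ t, ‖t‖ ≤ 1 → F t = 0 := by
  obtain ⟨A, hA, hs⟩ := hF
  have h := strassmann A (tendsto_zero_iff_norm_tendsto_zero.2 hA.tendsto_atTop_zero)
    (by
      refine hinf.mono ?_
      rintro t ⟨ht, h0⟩
      exact ⟨ht, by rw [(hs t ht).tsum_eq, h0]⟩)
  intro t ht
  have := hs t ht
  simp only [h, zero_mul] at this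
  exact this.unique hasSum_zero

lemma GoodOnDisc.add {𝕃 : Type*} [NontriviallyNormedField 𝕃] {F G : 𝕃 → 𝕃}
    (hF : GoodOnDisc F) (hG : GoodOnDisc G) : GoodOnDisc (fun t => F t + G t) := by
  obtain ⟨A, hA, hs⟩ := hF
  obtain ⟨B, hB, hs'⟩ := hG
  refine ⟨fun n => A n + B n, Summable.of_nonneg_of_le (fun _ => norm_nonneg _)
    (fun n => norm_add_le _ _) (hA.add hB), fun t ht => ?_⟩
  simpa only [add_mul] using (hs t ht).add (hs' t ht)

lemma GoodOnDisc.const {𝕃 : Type*} [NontriviallyNormedField 𝕃] (c : 𝕃) :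
    GoodOnDisc (fun _ => c) := by
  refine ⟨fun n => if n = 0 then c else 0, ?_, fun t _ => ?_⟩
  · apply summable_of_ne_finset_zero (s := {0})
    intro n hn
    simp at hn
    simp [hn]
  · convert hasSum_single (f := fun n => (if n = 0 then c else 0) * t ^ n) 0 ?_ using 1
    · simp
    · intro n hn; simp [hn]

lemma GoodOnDisc.mul {𝕃 : Type*} [NontriviallyNormedField 𝕃] [CompleteSpace 𝕃] {F G : 𝕃 → 𝕃}
    (hF : GoodOnDisc F) (hG : GoodOnDisc G) : GoodOnDisc (fun t => F t * G t) := by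
  obtain ⟨A, hA, hs⟩ := hF
  obtain ⟨B, hB, hs'⟩ := hG
  refine ⟨fun n => ∑ kl ∈ Finset.HasAntidiagonal.antidiagonal n, A kl.1 * B kl.2,
    summable_norm_sum_mul_antidiagonal_of_summable_norm hA hB, fun t ht => ?_⟩
  have hbd : ∀ (C : ℕ → 𝕃), Summable (fun n => ‖C n‖) → Summable (fun n => ‖C n * t ^ n‖) := by
    intro C hC
    refine Summable.of_nonneg_of_le (fun _ => norm_nonneg _) (fun n => ?_) hC
    rw [norm_mul, norm_pow]
    exact mul_le_of_le_one_right (norm_nonneg _) (pow_le_one₀ (norm_nonneg _) ht)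
  have e : (fun n => (∑ kl ∈ Finset.HasAntidiagonal.antidiagonal n, A kl.1 * B kl.2) * t ^ n) =
      fun n => ∑ kl ∈ Finset.HasAntidiagonal.antidiagonal n, (A kl.1 * t ^ kl.1) * (B kl.2 * t ^ kl.2) := by
    funext n
    rw [Finset.sum_mul]
    apply Finset.sum_congr rfl
    intro kl hkl
    rw [← Finset.HasAntidiagonal.mem_antidiagonal.1 hkl, pow_add]; ring
  show HasSum _ (F t * G t)
  rw [e, ← (hs t ht).tsum_eq, ← (hs' t ht).tsum_eq,
    tsum_mul_tsum_eq_tsum_sum_antidiagonal_of_summable_norm (hbd A hA) (hbd B hB)]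
  exact (summable_norm_sum_mul_antidiagonal_of_summable_norm (hbd A hA) (hbd B hB)).of_norm.hasSum

lemma GoodOnDisc.aeval {𝕃 : Type*} [NontriviallyNormedField 𝕃] [CompleteSpace 𝕃] [CharZero 𝕃]
    {F G : 𝕃 → 𝕃}
    (hF : GoodOnDisc F) (hG : GoodOnDisc G) (Q : MvPolynomial (Fin 2) ℚ) :
    GoodOnDisc (fun t => MvPolynomial.aeval ![F t, G t] Q) := by
  induction Q using MvPolynomial.induction_on with
  | C a => simpa using GoodOnDisc.const _
  | add p q hp hq => simpa using hp.add hq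
  | mul_X p i hp =>
    fin_cases i
    · simpa using hp.mul hF
    · simpa using hp.mul hG

lemma goodOnDisc_of_fps {𝕃 : Type*} [NontriviallyNormedField 𝕃] [CompleteSpace 𝕃]
    {φ : 𝕃 → 𝕃} {p : FormalMultilinearSeries 𝕃 𝕃 𝕃} {r : NNReal}
    (h : HasFPowerSeriesOnBall φ p 0 r) (l : 𝕃) (hl : ‖l‖ < r) :
    GoodOnDisc (fun t => φ (l * t)) := by
  refine ⟨fun n => p.coeff n * l ^ n, ?_, fun t ht => ?_⟩
  · have := p.summable_norm_mul_pow (r := ‖l‖₊) (lt_of_lt_of_le (by exact_mod_cast hl) h.r_le)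
    refine this.congr fun n => ?_
    rw [norm_mul, norm_pow, coe_nnnorm, FormalMultilinearSeries.norm_apply_eq_norm_coef]
  · have hlt : ‖l * t‖ < r := by
      rw [norm_mul]; exact (mul_le_of_le_one_right (norm_nonneg _) ht).trans_lt hl
    have := h.hasSum (y := l * t) (by
      rw [Metric.mem_eball, edist_zero_right]
      exact ENNReal.coe_lt_coe.2 hlt)
    rw [zero_add] at this
    refine this.congr_fun ?_ 
    intro n
    simp [mul_pow]; ring

lemma isAlg_root {F 𝕃 : Type*} [Field F] [Field 𝕃] [Algebra F 𝕃] (p : Polynomial 𝕃) (hp : p ≠ 0)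
    (hc : ∀ i, IsAlgebraic F (p.coeff i)) (x : 𝕃) (hx : p.eval x = 0) : IsAlgebraic F x := by
  have hl : p ∈ Polynomial.lifts (algebraMap (algebraicClosure F 𝕃) 𝕃) := by
    rw [Polynomial.lifts_iff_coeff_lifts]
    intro n
    exact ⟨⟨p.coeff n, mem_algebraicClosure_iff.2 (hc n)⟩, rfl⟩
  obtain ⟨q, hq⟩ := (Polynomial.mem_lifts _).1 hl
  have hx' : IsAlgebraic (algebraicClosure F 𝕃) x := by
    refine ⟨q, ?_, ?_⟩
    · rintro rfl
      exact hp (by rw [← hq, Polynomial.map_zero])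
    · rw [Polynomial.aeval_def, ← Polynomial.eval_map, hq, hx]
  exact hx'.restrictScalars F

lemma isAlg_eval {F 𝕃 : Type*} [Field F] [Field 𝕃] [Algebra F 𝕃] (p : Polynomial 𝕃)
    (hc : ∀ i, IsAlgebraic F (p.coeff i)) (x : 𝕃) (hx : IsAlgebraic F x) :
    IsAlgebraic F (p.eval x) := by
  rw [← mem_algebraicClosure_iff] at hx ⊢
  rw [Polynomial.eval_eq_sum_range]
  exact sum_mem fun i _ => mul_mem (mem_algebraicClosure_iff.2 (hc i)) (pow_mem hx i)

lemma isAlg_of_eval {F 𝕃 : Type*} [Field F] [Field 𝕃] [Algebra F 𝕃] (p : Polynomial 𝕃)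
    (hd : 1 ≤ p.natDegree)
    (hc : ∀ i, IsAlgebraic F (p.coeff i)) (x : 𝕃) (hx : IsAlgebraic F (p.eval x)) :
    IsAlgebraic F x := by
  apply isAlg_root (p - Polynomial.C (p.eval x)) _ _ x (by simp)
  · intro h
    have : p.natDegree = 0 := by
      rw [sub_eq_zero.1 h]; exact Polynomial.natDegree_C _
    omega
  · intro i
    rw [Polynomial.coeff_sub, Polynomial.coeff_C]
    split_ifs
    · exact (hc i).sub hx
    · simpa using hc i

lemma fin2_ext {m m' : Fin 2 →₀ ℕ} (h0 : m 0 = m' 0) (h1 : m 1 = m' 1) : m = m' := by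
  ext i; fin_cases i <;> assumption

open scoped IntermediateField in
lemma alg_of_rel {𝕃 : Type*} [Field 𝕃] [CharZero 𝕃] (P : MvPolynomial (Fin 2) 𝕃) (hP : P ≠ 0)
    (hc : ∀ m, IsAlgebraic ℚ (MvPolynomial.coeff m P)) (u V : 𝕃) (hV : Transcendental ℚ V)
    (F : IntermediateField ℚ 𝕃) (hVE : IsAlgebraic F V)
    (h : MvPolynomial.eval ![u, V] P = 0) : IsAlgebraic F u := by
  classical
  obtain ⟨m0, hm0⟩ := MvPolynomial.ne_zero_iff.1 hP
  refine isAlg_root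
    (∑ m ∈ P.support, Polynomial.C (MvPolynomial.coeff m P * V ^ m 1) * Polynomial.X ^ m 0)
    ?_ ?_ u ?_
  · intro h0
    have hcoe := congrArg (fun p => Polynomial.coeff p (m0 0)) h0
    simp only [Polynomial.finsetSum_coeff, Polynomial.coeff_C_mul_X_pow,
      Polynomial.coeff_zero] at hcoe
    apply hV
    refine isAlg_root (∑ m ∈ P.support, if m0 0 = m 0 then
      Polynomial.C (MvPolynomial.coeff m P) * Polynomial.X ^ m 1 else 0) ?_ ?_ V ?_
    · intro h1
      have := congrArg (fun p => Polynomial.coeff p (m0 1)) h1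
      simp only [Polynomial.finsetSum_coeff, Polynomial.coeff_zero] at this
      rw [Finset.sum_eq_single m0] at this
      · simp at this; exact hm0 this
      · intro m _ hne
        split_ifs with hh
        · rw [Polynomial.coeff_C_mul_X_pow, if_neg]
          exact fun h' => hne (fin2_ext hh h').symm
        · simp
      · intro hn; simp at hn; simp [hn]
    · intro i
      rw [Polynomial.finsetSum_coeff, ← mem_algebraicClosure_iff]
      refine sum_mem fun m _ => ?_
      split_ifs
      · rw [Polynomial.coeff_C_mul_X_pow]
        split_ifs
        · exact mem_algebraicClosure_iff.2 (hc m)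
        · exact zero_mem _
      · simp
    · rw [Polynomial.eval_finsetSum, ← hcoe]
      refine Finset.sum_congr rfl fun m _ => ?_
      split_ifs <;> simp
  · intro i
    rw [Polynomial.finsetSum_coeff, ← mem_algebraicClosure_iff]
    refine sum_mem fun m _ => ?_
    rw [Polynomial.coeff_C_mul_X_pow]
    split_ifs
    · exact mul_mem (mem_algebraicClosure_iff.2 ((hc m).extendScalars
        (algebraMap ℚ F).injective)) (pow_mem (mem_algebraicClosure_iff.2 hVE) _)
    · exact zero_mem _
  · rw [MvPolynomial.eval_eq'] at h
    rw [Polynomial.eval_finsetSum, ← h]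
    refine Finset.sum_congr rfl fun m _ => ?_
    simp [Fin.prod_univ_two]
    ring

open scoped IntermediateField IntermediateField.algebraAdjoinAdjoin in
lemma dep_of_alg {𝕃 : Type*} [Field 𝕃] [CharZero 𝕃] (x y V : 𝕃)
    (hx : IsAlgebraic ℚ⟮V⟯ x) (hy : IsAlgebraic ℚ⟮V⟯ y) :
    ∃ Q : MvPolynomial (Fin 2) ℚ, Q ≠ 0 ∧ MvPolynomial.aeval ![x, y] Q = 0 := by
  by_contra hcon
  push Not at hcon
  have hind : AlgebraicIndependent ℚ ![x, y] := by
    rw [algebraicIndependent_iff]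
    intro p hp
    by_contra h
    exact hcon p h hp
  have hxy : x ≠ y := by
    have := hind.injective.ne (show (0 : Fin 2) ≠ 1 by decide)
    simpa using this
  have hr : AlgebraicIndepOn ℚ id (Set.range ![x, y]) := AlgebraicIndependent.to_subtype_range hind
  have hI : (AlgebraicIndependent.matroid ℚ 𝕃).Indep {x, y} := by
    rw [AlgebraicIndependent.matroid_indep_iff]
    convert hr using 1
    simp [Set.pair_comm]
  have hmem : ∀ z, IsAlgebraic ℚ⟮V⟯ z → z ∈ (AlgebraicIndependent.matroid ℚ 𝕃).closure {V} := by
    intro z hz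
    rw [AlgebraicIndependent.matroid_closure_eq]
    exact (IsFractionRing.isAlgebraic_iff (Algebra.adjoin ℚ {V}) ℚ⟮V⟯ 𝕃).2 hz
  have h1 := hI.encard_le_eRk_of_subset (X := (AlgebraicIndependent.matroid ℚ 𝕃).closure {V})
    (by rintro z (rfl | rfl); exacts [hmem _ hx, hmem _ hy])
  rw [Matroid.eRk_closure_eq, Set.encard_pair hxy] at h1
  have h2 := h1.trans (Matroid.eRk_le_encard _ _)
  rw [Set.encard_singleton] at h2
  exact absurd h2 (by norm_num)

lemma lowest {𝕃 : Type*} [NontriviallyNormedField 𝕃] [CharZero 𝕃] (Q : MvPolynomial (Fin 2) ℚ)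
    (hQ : Q ≠ 0) (u₁ u₂ : 𝕃 → 𝕃) (l₁ l₂ : 𝕃) (hl₁ : l₁ ≠ 0)
    (h₁ : Filter.Tendsto u₁ (nhdsWithin 0 {0}ᶜ) (nhds l₁))
    (h₂ : Filter.Tendsto u₂ (nhdsWithin 0 {0}ᶜ) (nhds l₂))
    (h : ∀ᶠ t in nhdsWithin (0 : 𝕃) {0}ᶜ, MvPolynomial.aeval ![t * u₁ t, t * u₂ t] Q = 0) :
    IsAlgebraic ℚ (l₂ / l₁) := by
  classical
  have hne : Q.support.Nonempty := MvPolynomial.support_nonempty.2 hQ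
  obtain ⟨m0, hm0, hmin⟩ := Finset.exists_min_image Q.support (fun m => m 0 + m 1) hne
  have hzero : ∑ m ∈ Q.support, algebraMap ℚ 𝕃 (Q.coeff m) *
      ((0 : 𝕃) ^ (m 0 + m 1 - (m0 0 + m0 1)) * l₁ ^ m 0 * l₂ ^ m 1) = 0 := by
    have ht : Filter.Tendsto (fun t : 𝕃 => t) (nhdsWithin 0 {0}ᶜ) (nhds 0) :=
      tendsto_nhdsWithin_of_tendsto_nhds Filter.tendsto_id
    have hlim : Filter.Tendsto (fun t : 𝕃 => ∑ m ∈ Q.support, algebraMap ℚ 𝕃 (Q.coeff m) *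
      (t ^ (m 0 + m 1 - (m0 0 + m0 1)) * (u₁ t) ^ m 0 * (u₂ t) ^ m 1)) (nhdsWithin 0 {0}ᶜ)
      (nhds (∑ m ∈ Q.support, algebraMap ℚ 𝕃 (Q.coeff m) *
      ((0 : 𝕃) ^ (m 0 + m 1 - (m0 0 + m0 1)) * l₁ ^ m 0 * l₂ ^ m 1))) :=
      tendsto_finsetSum _ fun m _ => Filter.Tendsto.const_mul _
        (((ht.pow _).mul (h₁.pow _)).mul (h₂.pow _))
    refine tendsto_nhds_unique hlim (tendsto_const_nhds.congr' ?_)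
    filter_upwards [h, self_mem_nhdsWithin] with t h0 ht0
    have ht0 : t ≠ 0 := ht0
    apply mul_left_cancel₀ (pow_ne_zero (m0 0 + m0 1) ht0)
    rw [mul_zero, ← h0, MvPolynomial.aeval_def, MvPolynomial.eval₂_eq', Finset.mul_sum]
    refine Finset.sum_congr rfl fun m hm => ?_
    have e : t ^ m 0 * t ^ m 1 = t ^ (m0 0 + m0 1) * t ^ (m 0 + m 1 - (m0 0 + m0 1)) := by
      rw [← pow_add, ← pow_add, Nat.add_sub_cancel' (hmin m hm)]
    simp only [Fin.prod_univ_two, Matrix.cons_val_zero, Matrix.cons_val_one]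
    rw [mul_pow, mul_pow]
    linear_combination (algebraMap ℚ 𝕃 (Q.coeff m) * (u₁ t) ^ m 0 * (u₂ t) ^ m 1) * e
  refine ⟨∑ m ∈ Q.support, if m 0 + m 1 = m0 0 + m0 1 then
    Polynomial.C (Q.coeff m) * Polynomial.X ^ m 1 else 0, ?_, ?_⟩
  · intro h1
    have := congrArg (fun p => Polynomial.coeff p (m0 1)) h1
    simp only [Polynomial.finsetSum_coeff, Polynomial.coeff_zero] at this
    rw [Finset.sum_eq_single m0] at this
    · simp at this; exact (MvPolynomial.mem_support_iff.1 hm0) this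
    · intro m _ hne
      split_ifs with hh
      · rw [Polynomial.coeff_C_mul_X_pow, if_neg]
        exact fun h' => hne (fin2_ext (by omega) h'.symm)
      · simp
    · exact fun hn => absurd hm0 hn
  · apply mul_left_cancel₀ (pow_ne_zero (m0 0 + m0 1) hl₁)
    rw [mul_zero, ← hzero, map_sum, Finset.mul_sum]
    refine Finset.sum_congr rfl fun m hm => ?_
    split_ifs with hh
    · rw [hh, Nat.sub_self, ← hh]
      simp only [map_mul, Polynomial.aeval_C, map_pow, Polynomial.aeval_X]
      rw [pow_add, div_pow]
      field_simp
    · have := hmin m hm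
      have : m 0 + m 1 - (m0 0 + m0 1) ≠ 0 := by omega
      simp [zero_pow this]

lemma exists_zpow_eq {𝕃 : Type*} [Field 𝕃] [IsAlgClosed 𝕃] (k : ℤ) (hk : k ≠ 0) (b : 𝕃)
    (hb : b ≠ 0) : ∃ y : 𝕃, y ≠ 0 ∧ y ^ k = b := by
  obtain ⟨n, rfl | rfl⟩ := k.eq_nat_or_neg
  · have hn : 0 < n := by omega
    obtain ⟨z, hz⟩ := IsAlgClosed.exists_pow_nat_eq b hn
    exact ⟨z, by rintro rfl; exact hb (by rw [← hz, zero_pow hn.ne']), by simpa using hz⟩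
  · have hn : 0 < n := by omega
    obtain ⟨z, hz⟩ := IsAlgClosed.exists_pow_nat_eq b⁻¹ hn
    exact ⟨z, by rintro rfl; exact inv_ne_zero hb (by rw [← hz, zero_pow hn.ne']),
      by simp [hz]⟩

lemma countable_zpow_preimage {𝕃 : Type*} [Field 𝕃] (k : ℤ) (hk : k ≠ 0)
    (Z : Set 𝕃) (hZ : Z.Countable) : {t : 𝕃 | t ^ k ∈ Z}.Countable := by
  have hfib : ∀ n : ℕ, 0 < n → ∀ b : 𝕃, {t : 𝕃 | t ^ n = b}.Finite := by
    intro n hn b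
    classical
    refine (Polynomial.nthRoots n b).toFinset.finite_toSet.subset fun t ht => ?_
    simpa [Polynomial.mem_nthRoots hn] using ht
  have hfib' : ∀ b : 𝕃, {t : 𝕃 | t ^ k = b}.Finite := by
    intro b
    obtain ⟨n, rfl | rfl⟩ := k.eq_nat_or_neg
    · simpa using hfib n (by omega) b
    · refine (hfib n (by omega) b⁻¹).subset fun t ht => ?_
      have ht : t ^ (-(n : ℤ)) = b := ht
      rw [zpow_neg, zpow_natCast] at ht
      show t ^ n = b⁻¹
      rw [← ht, inv_inv]
  have : {t : 𝕃 | t ^ k ∈ Z} = ⋃ b ∈ Z, {t : 𝕃 | t ^ k = b} := by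
    ext t; simp
  rw [this]
  exact hZ.biUnion fun b _ => (hfib' b).countable

lemma sphere_uncountable {𝕃 : Type*} [NontriviallyNormedField 𝕃] [CompleteSpace 𝕃]
    [IsUltrametricDist 𝕃] : ¬ {t : 𝕃 | ‖t‖ = 1}.Countable := by
  intro h
  have hs : Metric.ball (1 : 𝕃) 1 ⊆ {t : 𝕃 | ‖t‖ = 1} := by
    intro t ht
    rw [mem_ball_iff_norm] at ht
    have h1 : ‖(1 : 𝕃)‖ = 1 := norm_one
    have := IsUltrametricDist.norm_add_eq_max_of_norm_ne_norm (x := t - 1) (y := (1 : 𝕃))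
      (by rw [h1]; exact ht.ne)
    rw [sub_add_cancel, h1, max_eq_right ht.le] at this
    exact this
  have hc := (h.mono hs).le_aleph0
  have := continuum_le_cardinal_of_isOpen 𝕃 (s := Metric.ball (1 : 𝕃) 1) Metric.isOpen_ball
    ⟨1, Metric.mem_ball_self one_pos⟩
  exact absurd (this.trans hc) (not_le.2 Cardinal.aleph0_lt_continuum)

lemma countable_mvp : Countable (MvPolynomial (Fin 2) ℚ) :=
  Cardinal.mk_le_aleph0_iff.1 (MvPolynomial.cardinalMk_le_max.trans (by simp))

lemma isAlg_of_zpow {𝕃 : Type*} [Field 𝕃] [CharZero 𝕃] (x : 𝕃) (k : ℤ) (hk : k ≠ 0)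
    (h : IsAlgebraic ℚ (x ^ k)) : IsAlgebraic ℚ x := by
  obtain ⟨n, rfl | rfl⟩ := k.eq_nat_or_neg
  · rw [zpow_natCast] at h
    exact h.of_pow (by omega)
  · rw [zpow_neg, zpow_natCast] at h
    exact (IsAlgebraic.inv_iff.1 h).of_pow (by omega)

lemma isAlg_zpow {𝕃 : Type*} [Field 𝕃] [CharZero 𝕃] (x : 𝕃) (k : ℤ)
    (h : IsAlgebraic ℚ x) : IsAlgebraic ℚ (x ^ k) := by
  rw [← mem_algebraicClosure_iff] at h ⊢
  exact zpow_mem h k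

lemma c_trans {𝕃 : Type*} [Field 𝕃] [CharZero 𝕃] (ζ₁ ζ₂ a q y : 𝕃) (h1 : IsAlgebraic ℚ ζ₁)
    (h2 : IsAlgebraic ℚ ζ₂) (hz1 : ζ₁ ≠ 0) (hz2 : ζ₂ ≠ 0) (ha : Transcendental ℚ a)
    (k₁ k₂ : ℤ) (hk2 : k₂ ≠ 0) (hk : k₁ ≠ k₂) (d : ℕ) (hd : 2 ≤ d) (hq : q ^ d = ζ₂ * a)
    (hy0 : y ≠ 0) (hy : y ^ k₂ = q / (ζ₂ * a))
    (h : IsAlgebraic ℚ ((ζ₁ * a * y ^ k₁) ^ d / (ζ₁ * a))) : False := by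
  have ha0 : a ≠ 0 := by rintro rfl; exact ha isAlgebraic_zero
  obtain ⟨e, rfl⟩ : ∃ e, d = e + 1 := ⟨d - 1, by omega⟩
  have hq0 : q ≠ 0 := by rintro rfl; simp [hz2, ha0] at hq
  have key : ((ζ₁ * a * y ^ k₁) ^ (e + 1) / (ζ₁ * a)) ^ k₂ =
      ((ζ₁ * a) ^ k₂ * ((ζ₂ * a) ^ k₁)⁻¹) ^ e := by
    have e1 : (ζ₁ * a * y ^ k₁) ^ (e + 1) / (ζ₁ * a) = (ζ₁ * a) ^ e * (y ^ k₁) ^ (e + 1) := by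
      field_simp
      ring
    have e2 : ((y ^ k₁) ^ (e + 1)) ^ k₂ = (((ζ₂ * a) ^ k₁)⁻¹) ^ e := by
      have : ((y ^ k₁) ^ (e + 1)) ^ k₂ = ((y ^ k₂) ^ (e + 1)) ^ k₁ := by
        simp only [← zpow_natCast, ← zpow_mul]
        congr 1; ring
      rw [this, hy, div_pow, hq]
      have : ζ₂ * a / (ζ₂ * a) ^ (e + 1) = ((ζ₂ * a) ^ e)⁻¹ := by
        field_simp
        ring
      rw [this]
      simp only [← zpow_natCast, ← zpow_mul, ← zpow_neg]
      congr 1; ring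
    rw [e1, mul_zpow, e2, mul_pow ((ζ₁ * a) ^ k₂)]
    congr 1
    simp only [← zpow_natCast, ← zpow_mul]
    congr 1; ring
  have h3 := isAlg_zpow _ k₂ h
  rw [key] at h3
  have h4 := h3.of_pow (by omega)
  have e3 : (ζ₁ * a) ^ k₂ * ((ζ₂ * a) ^ k₁)⁻¹ = (ζ₁ ^ k₂ / ζ₂ ^ k₁) * a ^ (k₂ - k₁) := by
    rw [mul_zpow, mul_zpow, zpow_sub₀ ha0]
    have := zpow_ne_zero k₁ ha0
    have := zpow_ne_zero k₁ hz2
    field_simp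
  rw [e3] at h4
  have hne : ζ₁ ^ k₂ / ζ₂ ^ k₁ ≠ 0 := div_ne_zero (zpow_ne_zero _ hz1) (zpow_ne_zero _ hz2)
  have h5 : IsAlgebraic ℚ (ζ₁ ^ k₂ / ζ₂ ^ k₁) := by
    rw [div_eq_mul_inv]
    exact (isAlg_zpow _ _ h1).mul (isAlg_zpow _ _ h2).inv
  have h6 := h5.inv.mul h4
  rw [inv_mul_cancel_left₀ hne] at h6
  exact ha (isAlg_of_zpow a (k₂ - k₁) (by omega) h6)

lemma psi_iter {𝕃 : Type*} [NontriviallyNormedField 𝕃] [CharZero 𝕃]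
    (f : Polynomial 𝕃) (hdeg : 2 ≤ f.natDegree)
    (F : IntermediateField ℚ 𝕃) (hf : ∀ i : ℕ, IsAlgebraic F (f.coeff i))
    (R : ℝ) (hR1 : R ≤ 1) (Ψ : 𝕃 → 𝕃)
    (hΨfun : ∀ z : 𝕃, z ≠ 0 → ‖z‖ < R → Ψ (z ^ f.natDegree) = f.eval (Ψ z))
    (z : 𝕃) (hz0 : z ≠ 0) (hz : ‖z‖ < R) (h : IsAlgebraic F (Ψ z)) (n : ℕ) :
    IsAlgebraic F (Ψ (z ^ f.natDegree ^ n)) := by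
  induction n with
  | zero => simpa using h
  | succ n ih =>
    rw [pow_succ f.natDegree, pow_mul, hΨfun _ (pow_ne_zero _ hz0)]
    · exact isAlg_eval f hf _ ih
    · rw [norm_pow]
      exact (pow_le_of_le_one (norm_nonneg _) (hz.le.trans hR1)
        (pow_ne_zero _ (by omega))).trans_lt hz

open scoped IntermediateField in
lemma per_t {𝕃 : Type*} [NontriviallyNormedField 𝕃] [CharZero 𝕃]
    (f : Polynomial 𝕃) (hdeg : 2 ≤ f.natDegree)
    (hfalg : ∀ i : ℕ, IsAlgebraic ℚ (f.coeff i))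
    (R : ℝ) (hR1 : R ≤ 1) (Ψ : 𝕃 → 𝕃)
    (hΨfun : ∀ z : 𝕃, z ≠ 0 → ‖z‖ < R → Ψ (z ^ f.natDegree) = f.eval (Ψ z))
    (P : MvPolynomial (Fin 2) 𝕃) (hPne : P ≠ 0)
    (hPalg : ∀ m, IsAlgebraic ℚ (MvPolynomial.coeff m P))
    (s w σ ω : 𝕃) (hs0 : s ≠ 0) (hs : ‖s‖ < R) (hσ0 : σ ≠ 0) (hσ : ‖σ‖ < R)
    (hω0 : ω ≠ 0) (hω : ‖ω‖ < R) (hw : ω ^ f.natDegree = w)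
    (h1 : MvPolynomial.eval ![1 / Ψ s, 1 / Ψ w] P = 0)
    (h2 : MvPolynomial.eval ![1 / Ψ σ, 1 / Ψ ω] P = 0)
    (hV : Transcendental ℚ (Ψ w)) (n : ℕ) :
    ∃ Q : MvPolynomial (Fin 2) ℚ, Q ≠ 0 ∧
      MvPolynomial.aeval ![1 / Ψ (s ^ f.natDegree ^ n), 1 / Ψ (σ ^ f.natDegree ^ (n + 1))] Q = 0 := by
  have hinv : ∀ (F : IntermediateField ℚ 𝕃) (x : 𝕃), IsAlgebraic F (1 / x) ↔ IsAlgebraic F x := by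
    intro F x
    rw [one_div, IsAlgebraic.inv_iff]
  have htr : ∀ x : 𝕃, Transcendental ℚ x → Transcendental ℚ (1 / x) := by
    intro x hx h
    rw [one_div, IsAlgebraic.inv_iff] at h
    exact hx h
  have hVE : IsAlgebraic ℚ⟮Ψ w⟯ (Ψ w) :=
    isAlgebraic_algebraMap (⟨Ψ w, IntermediateField.mem_adjoin_simple_self ℚ (Ψ w)⟩ : ℚ⟮Ψ w⟯)
  have hfF : ∀ i : ℕ, IsAlgebraic ℚ⟮Ψ w⟯ (f.coeff i) := fun i =>
    (hfalg i).extendScalars (algebraMap ℚ ℚ⟮Ψ w⟯).injective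
  have hww : Ψ w = f.eval (Ψ ω) := by rw [← hw, hΨfun ω hω0 hω]
  have hωF : IsAlgebraic ℚ⟮Ψ w⟯ (Ψ ω) :=
    isAlg_of_eval f (by omega) hfF _ (by rw [← hww]; exact hVE)
  have hωT : Transcendental ℚ (Ψ ω) := by
    intro h
    apply hV
    rw [hww]
    exact isAlg_eval f hfalg _ h
  have hsF : IsAlgebraic ℚ⟮Ψ w⟯ (Ψ s) :=
    (hinv _ _).1 (alg_of_rel P hPne hPalg _ _ (htr _ hV) _ ((hinv _ _).2 hVE) h1)
  have hσF : IsAlgebraic ℚ⟮Ψ w⟯ (Ψ σ) :=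
    (hinv _ _).1 (alg_of_rel P hPne hPalg _ _ (htr _ hωT) _ ((hinv _ _).2 hωF) h2)
  exact dep_of_alg _ _ (Ψ w)
    ((hinv _ _).2 (psi_iter f hdeg _ hfF R hR1 Ψ hΨfun s hs0 hs hsF n))
    ((hinv _ _).2 (psi_iter f hdeg _ hfF R hR1 Ψ hΨfun σ hσ0 hσ hσF (n + 1)))

lemma bad_countable {𝕃 : Type*} [NontriviallyNormedField 𝕃] [CharZero 𝕃] [CompleteSpace 𝕃]
    [IsUltrametricDist 𝕃] (φ : 𝕃 → 𝕃) (l : 𝕃) (hG : GoodOnDisc (fun t => φ (l * t)))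
    (hφ0 : φ 0 = 0) (hφ1 : φ l ≠ 0) :
    {τ : 𝕃 | ‖τ‖ ≤ 1 ∧ IsAlgebraic ℚ (φ (l * τ))}.Countable := by
  have hfin : ∀ v : 𝕃, {τ : 𝕃 | ‖τ‖ ≤ 1 ∧ φ (l * τ) = v}.Finite := by
    intro v
    by_contra hinf
    have hG2 : GoodOnDisc (fun t => φ (l * t) + (-v)) := hG.add (GoodOnDisc.const _)
    have hz := hG2.eq_zero (by
      refine Set.Infinite.mono ?_ hinf
      rintro τ ⟨h1, h2⟩
      exact ⟨h1, by simp [h2]⟩)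
    have z0 := hz 0 (by simp)
    have z1 := hz 1 (by simp)
    simp only [mul_zero, mul_one, hφ0] at z0 z1
    apply hφ1
    linear_combination z1 - z0
  have : {τ : 𝕃 | ‖τ‖ ≤ 1 ∧ IsAlgebraic ℚ (φ (l * τ))} =
      ⋃ v ∈ {x : 𝕃 | IsAlgebraic ℚ x}, {τ : 𝕃 | ‖τ‖ ≤ 1 ∧ φ (l * τ) = v} := by
    ext τ
    simp only [Set.mem_ofPred_eq, Set.mem_iUnion, exists_prop]
    constructor
    · rintro ⟨h1, h2⟩
      exact ⟨_, h2, h1, rfl⟩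
    · rintro ⟨v, h2, h1, rfl⟩
      exact ⟨h1, h2⟩
  rw [this]
  exact (Algebraic.countable ℚ 𝕃).biUnion fun v _ => (hfin v).countable

lemma zpow_le_max (r : ℝ) (hr : 0 < r) (k₁ k₂ : ℤ) (hk : |k₁| ≤ |k₂|) (h : 1 ≤ r ^ k₂) :
    r ^ k₁ ≤ r ^ k₂ := by
  rcases le_total 1 r with h1 | h1
  · rcases le_or_gt 0 k₂ with h2 | h2
    · exact zpow_le_zpow_right₀ h1 (by rw [abs_of_nonneg h2] at hk; exact (le_abs_self _).trans hk)
    · have h3 : r ^ k₂ = 1 := le_antisymm (zpow_le_one_of_nonpos₀ h1 h2.le) h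
      have h4 : r = 1 := by
        rcases h1.eq_or_lt with h5 | h5
        · exact h5.symm
        · exact absurd h3 (zpow_lt_one_of_neg₀ h5 h2).ne
      simp [h4]
  · rcases le_or_gt k₂ 0 with h2 | h2
    · refine zpow_le_zpow_right_of_le_one₀ hr h1 ?_
      rw [abs_of_nonpos h2] at hk
      have := neg_abs_le k₁
      omega
    · rcases h1.eq_or_lt with h5 | h5
      · simp [h5]
      · exact absurd h (not_le.2 (zpow_lt_one₀ hr h5 h2))

lemma exists_phi {𝕃 : Type*} [NontriviallyNormedField 𝕃] [CompleteSpace 𝕃]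
    (R : ℝ) (hR0 : 0 < R) (Ψ h : 𝕃 → 𝕃) (hh : AnalyticOnNhd 𝕃 h (Metric.ball 0 R))
    (h0 : h 0 = 1) (hΨh : ∀ z : 𝕃, z ≠ 0 → ‖z‖ < R → z * Ψ z = h z) :
    ∃ (φ : 𝕃 → 𝕃) (p : FormalMultilinearSeries 𝕃 𝕃 𝕃) (r : NNReal), 0 < r ∧ (r : ℝ) ≤ R ∧
      HasFPowerSeriesOnBall φ p 0 r ∧ φ 0 = 0 ∧ (∀ z, z ≠ 0 → ‖z‖ < R → φ z = 1 / Ψ z) ∧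
      (∀ l : 𝕃, ∃ u : 𝕃 → 𝕃, Filter.Tendsto u (nhdsWithin 0 {0}ᶜ) (nhds l) ∧
        ∀ t, φ (l * t) = t * u t) := by
  have ha : AnalyticAt 𝕃 h 0 := hh 0 (Metric.mem_ball_self hR0)
  have hφ : AnalyticAt 𝕃 (fun z => z * (h z)⁻¹) 0 :=
    analyticAt_id.mul (ha.inv (by rw [h0]; exact one_ne_zero))
  obtain ⟨p, r, hp⟩ := hφ
  obtain ⟨r', hr'0, hr'⟩ := ENNReal.lt_iff_exists_nnreal_btwn.1 hp.r_pos
  refine ⟨_, p, min r' ⟨R, hR0.le⟩, ?_, ?_, hp.mono ?_ ?_, by simp, ?_, ?_⟩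
  · exact lt_min (by exact_mod_cast hr'0) hR0
  · exact NNReal.coe_le_coe.2 (min_le_right _ _)
  · exact_mod_cast lt_min (show (0 : NNReal) < r' by exact_mod_cast hr'0)
      (show (0 : NNReal) < ⟨R, hR0.le⟩ from hR0)
  · refine le_trans ?_ hr'.le
    exact_mod_cast min_le_left _ _
  · intro z hz hzR
    rw [← hΨh z hz hzR, mul_inv, mul_inv_cancel_left₀ hz, one_div]
  · intro l
    refine ⟨fun t => l * (h (l * t))⁻¹, ?_, fun t => by ring⟩
    have hc : ContinuousAt (fun t => h (l * t)) 0 := by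
      have h1 : ContinuousAt h (l * 0) := by rw [mul_zero]; exact ha.continuousAt
      exact ContinuousAt.comp (f := fun t => l * t) h1 (by fun_prop)
    have h2 : Filter.Tendsto (fun t => l * (h (l * t))⁻¹) (nhds 0) (nhds (l * 1)) := by
      refine Filter.Tendsto.const_mul _ ?_
      have h3 := hc.tendsto
      simp only [mul_zero, h0] at h3
      simpa using h3.inv₀ one_ne_zero
    rw [mul_one] at h2
    exact tendsto_nhdsWithin_of_tendsto_nhds h2

lemma exists_pow_pow_lt (d : ℕ) (hd : 2 ≤ d) (r x y z : ℝ) (hr : 0 < r)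
    (hx0 : 0 ≤ x) (hx : x < 1) (hy0 : 0 ≤ y) (hy : y < 1) (hz0 : 0 ≤ z) (hz : z < 1) :
    ∃ n : ℕ, x ^ d ^ n < r ∧ y ^ d ^ n < r ∧ z ^ d ^ n < r := by
  have ht : Filter.Tendsto (fun n : ℕ => d ^ n) Filter.atTop Filter.atTop :=
    tendsto_pow_atTop_atTop_of_one_lt (by omega)
  have key : ∀ x : ℝ, 0 ≤ x → x < 1 → ∀ᶠ n in Filter.atTop, x ^ d ^ n < r := fun x h0 h1 =>
    ((tendsto_pow_atTop_nhds_zero_of_lt_one h0 h1).comp ht).eventually (gt_mem_nhds hr)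
  exact ((key x hx0 hx).and ((key y hy0 hy).and (key z hz0 hz))).exists

lemma main_le {𝕃 : Type*} [NontriviallyNormedField 𝕃] [IsAlgClosed 𝕃] [CharZero 𝕃]
    [CompleteSpace 𝕃] [IsUltrametricDist 𝕃]
    (f : Polynomial 𝕃) (hdeg : 2 ≤ f.natDegree)
    (hfalg : ∀ i : ℕ, IsAlgebraic ℚ (f.coeff i))
    (R : ℝ) (hR0 : 0 < R) (hR1 : R ≤ 1)
    (Ψ : 𝕃 → 𝕃)
    (hΨext : ∃ h : 𝕃 → 𝕃, AnalyticOnNhd 𝕃 h (Metric.ball 0 R) ∧ h 0 = 1 ∧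
      ∀ z : 𝕃, z ≠ 0 → ‖z‖ < R → z * Ψ z = h z)
    (hΨfun : ∀ z : 𝕃, z ≠ 0 → ‖z‖ < R → Ψ (z ^ f.natDegree) = f.eval (Ψ z))
    (hΨnorm : ∀ z : 𝕃, z ≠ 0 → ‖z‖ < R → ‖Ψ z‖ = ‖z‖⁻¹)
    (P : MvPolynomial (Fin 2) 𝕃) (hPne : P ≠ 0)
    (hPalg : ∀ m, IsAlgebraic ℚ (MvPolynomial.coeff m P))
    (ζ₁ ζ₂ : 𝕃) (hζ₁ : ∃ n : ℕ, 1 ≤ n ∧ ζ₁ ^ n = 1) (hζ₂ : ∃ n : ℕ, 1 ≤ n ∧ ζ₂ ^ n = 1)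
    (k₁ k₂ : ℤ) (hk1 : k₁ ≠ 0) (hk2 : k₂ ≠ 0) (hk12 : k₁ ≠ k₂) (hkle : |k₁| ≤ |k₂|)
    (a : 𝕃) (ha : Transcendental ℚ a) (haR : ‖a‖ < R ^ f.natDegree)
    (hzero : ∀ x : 𝕃,
      0 < ‖a * x ^ k₁‖ → ‖a * x ^ k₁‖ < R →
      0 < ‖a * x ^ k₂‖ → ‖a * x ^ k₂‖ < R →
      MvPolynomial.eval ![1 / Ψ (ζ₁ * a * x ^ k₁), 1 / Ψ (ζ₂ * a * x ^ k₂)] P = 0) : False := by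
  have hroot : ∀ ζ : 𝕃, (∃ n : ℕ, 1 ≤ n ∧ ζ ^ n = 1) → ‖ζ‖ = 1 ∧ ζ ≠ 0 ∧ IsAlgebraic ℚ ζ := by
    rintro ζ ⟨n, hn, h⟩
    refine ⟨(pow_eq_one_iff_of_nonneg (norm_nonneg ζ) (n := n) (by omega)).1 (by rw [← norm_pow, h, norm_one]), ?_, ?_⟩
    · rintro rfl
      rw [zero_pow (by omega)] at h
      exact zero_ne_one h
    · refine IsAlgebraic.of_pow (n := n) (by omega) ?_
      rw [h]; exact isAlgebraic_one
  obtain ⟨hn1, hz1, halg1⟩ := hroot ζ₁ hζ₁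
  obtain ⟨hn2, hz2, halg2⟩ := hroot ζ₂ hζ₂
  have ha0 : a ≠ 0 := by rintro rfl; exact ha isAlgebraic_zero
  obtain ⟨h, hh, h0, hΨh⟩ := hΨext
  obtain ⟨φ, p, r, hr0, hrR, hp, hφ0, hφ, hφu⟩ := exists_phi R hR0 Ψ h hh h0 hΨh
  generalize hd : f.natDegree = d at *
  have hd0 : d ≠ 0 := by omega
  set A1 := ζ₁ * a with hA1
  set A2 := ζ₂ * a with hA2
  have hA10 : A1 ≠ 0 := mul_ne_zero hz1 ha0
  have hA20 : A2 ≠ 0 := mul_ne_zero hz2 ha0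
  have hA1n : ‖A1‖ = ‖a‖ := by rw [hA1, norm_mul, hn1, one_mul]
  have hA2n : ‖A2‖ = ‖a‖ := by rw [hA2, norm_mul, hn2, one_mul]
  have haR' : ‖a‖ < R := haR.trans_le (pow_le_of_le_one hR0.le hR1 hd0)
  obtain ⟨q, hq⟩ := IsAlgClosed.exists_pow_nat_eq A2 (show 0 < d by omega)
  have hq0 : q ≠ 0 := by rintro rfl; rw [zero_pow hd0] at hq; exact hA20 hq.symm
  have hqn : ‖q‖ ^ d = ‖a‖ := by rw [← norm_pow, hq, hA2n]
  have hqR : ‖q‖ < R := lt_of_pow_lt_pow_left₀ d hR0.le (by rw [hqn]; exact haR)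
  have hqa : ‖a‖ ≤ ‖q‖ := by
    rw [← hqn]; exact pow_le_of_le_one (norm_nonneg _) (hqR.le.trans hR1) hd0
  have hapos : 0 < ‖a‖ := norm_pos_iff.2 ha0
  obtain ⟨y0, hy00, hy0⟩ := exists_zpow_eq k₂ hk2 (q / A2) (div_ne_zero hq0 hA20)
  have hy0n : ‖y0‖ ^ k₂ = ‖q‖ / ‖a‖ := by rw [← norm_zpow, hy0, norm_div, hA2n]
  have hy0k1 : ‖y0‖ ^ k₁ ≤ ‖q‖ / ‖a‖ := by
    rw [← hy0n]
    refine zpow_le_max _ (norm_pos_iff.2 hy00) _ _ hkle ?_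
    rw [hy0n, le_div_iff₀ hapos, one_mul]
    exact hqa
  have hay1 : ‖a * y0 ^ k₁‖ < R := by
    rw [norm_mul, norm_zpow]
    refine lt_of_le_of_lt (mul_le_mul_of_nonneg_left hy0k1 hapos.le) ?_
    rwa [mul_div_cancel₀ _ hapos.ne']
  have hay2 : ‖a * y0 ^ k₂‖ < R := by
    rw [norm_mul, norm_zpow, hy0n]
    rwa [mul_div_cancel₀ _ hapos.ne']
  set B := A1 * y0 ^ k₁ with hB
  have hB0 : B ≠ 0 := mul_ne_zero hA10 (zpow_ne_zero _ hy00)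
  have hBR : ‖B‖ < R := by rw [hB, norm_mul, hA1n, ← norm_mul]; exact hay1
  have hctr : ¬ IsAlgebraic ℚ (B ^ d / A1) := fun hc =>
    c_trans ζ₁ ζ₂ a q y0 halg1 halg2 hz1 hz2 ha k₁ k₂ hk2 hk12 d hdeg hq hy00 hy0 hc
  obtain ⟨n, hnA1, hnA2, hnB⟩ := exists_pow_pow_lt d hdeg r ‖A1‖ ‖A2‖ (‖B‖ ^ d)
    (by exact_mod_cast hr0) (norm_nonneg _) (by rw [hA1n]; linarith) (norm_nonneg _)
    (by rw [hA2n]; linarith) (by positivity)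
    (pow_lt_one₀ (norm_nonneg _) (by linarith) hd0)
  set D := d ^ n with hD
  have hD0 : D ≠ 0 := pow_ne_zero _ hd0
  set L1 := A1 ^ D with hL1
  set L2 := (B ^ d) ^ D with hL2
  set L3 := A2 ^ D with hL3
  have hL1r : ‖L1‖ < r := by rw [hL1, norm_pow]; exact hnA1
  have hL2r : ‖L2‖ < r := by rw [hL2, norm_pow, norm_pow]; exact hnB
  have hL3r : ‖L3‖ < r := by rw [hL3, norm_pow]; exact hnA2
  have hG1 := goodOnDisc_of_fps hp L1 hL1r
  have hG2 := goodOnDisc_of_fps hp L2 hL2r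
  have hG3 := goodOnDisc_of_fps hp L3 hL3r
  have hL10 : L1 ≠ 0 := pow_ne_zero _ hA10
  have hL20 : L2 ≠ 0 := pow_ne_zero _ (pow_ne_zero _ hB0)
  have hL30 : L3 ≠ 0 := pow_ne_zero _ hA20
  have hφL3 : φ L3 ≠ 0 := by
    rw [hφ L3 hL30 (hL3r.trans_le hrR)]
    have := hΨnorm L3 hL30 (hL3r.trans_le hrR)
    intro h
    have hΨ0 : Ψ L3 = 0 := by simpa using h
    rw [hΨ0, norm_zero] at this
    exact hL30 (norm_eq_zero.1 (inv_eq_zero.1 this.symm))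
  have hdk1 : k₁ * (d * D : ℕ) ≠ 0 := mul_ne_zero hk1 (by positivity)
  have hdk2 : k₂ * (d * D : ℕ) ≠ 0 := mul_ne_zero hk2 (by positivity)
  have hbad := countable_zpow_preimage _ hdk2 _ (bad_countable φ L3 hG3 hφ0 hφL3)
  have hgood : ∀ t : 𝕃, ‖t‖ = 1 → ¬ t ∈ {t : 𝕃 | t ^ (k₂ * (d * D : ℕ)) ∈
      {τ : 𝕃 | ‖τ‖ ≤ 1 ∧ IsAlgebraic ℚ (φ (L3 * τ))}} →
      ∃ Q : MvPolynomial (Fin 2) ℚ, Q ≠ 0 ∧ MvPolynomial.aeval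
        ![φ (L1 * t ^ (k₁ * (d * D : ℕ))), φ (L2 * t ^ (k₁ * (d * D : ℕ)))] Q = 0 := by
    intro t ht hnb
    have ht0 : t ≠ 0 := by rintro rfl; simp at ht
    have htn : ∀ k : ℤ, ‖t ^ k‖ = 1 := fun k => by rw [norm_zpow, ht, one_zpow]
    have htk : ∀ k : ℤ, t ^ k ≠ 0 := fun k => zpow_ne_zero k ht0
    have e1 : ∀ k : ℤ, (t ^ d) ^ k = (t ^ k) ^ d := fun k => by
      simp only [← zpow_natCast, ← zpow_mul]
      congr 1; ring
    have e2 : ∀ k : ℤ, t ^ (k * (d * D : ℕ)) = (((t ^ k) ^ d) ^ D) := fun k => by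
      rw [zpow_mul, zpow_natCast, pow_mul]
    have hs0 : A1 * (t ^ k₁) ^ d ≠ 0 := mul_ne_zero hA10 (pow_ne_zero _ (htk _))
    have hs : ‖A1 * (t ^ k₁) ^ d‖ < R := by rw [norm_mul, norm_pow, htn, one_pow, mul_one, hA1n]; exact haR'
    have hw0 : A2 * (t ^ k₂) ^ d ≠ 0 := mul_ne_zero hA20 (pow_ne_zero _ (htk _))
    have hw : ‖A2 * (t ^ k₂) ^ d‖ < R := by rw [norm_mul, norm_pow, htn, one_pow, mul_one, hA2n]; exact haR'
    have hσ0 : B * t ^ k₁ ≠ 0 := mul_ne_zero hB0 (htk _)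
    have hσ : ‖B * t ^ k₁‖ < R := by rw [norm_mul, htn, mul_one]; exact hBR
    have hω0 : q * t ^ k₂ ≠ 0 := mul_ne_zero hq0 (htk _)
    have hω : ‖q * t ^ k₂‖ < R := by rw [norm_mul, htn, mul_one]; exact hqR
    have r1 : MvPolynomial.eval ![1 / Ψ (A1 * (t ^ k₁) ^ d), 1 / Ψ (A2 * (t ^ k₂) ^ d)] P = 0 := by
      have hn : ∀ k : ℤ, ‖a * (t ^ d) ^ k‖ = ‖a‖ := fun k => by
        rw [e1, norm_mul, norm_pow, htn, one_pow, mul_one]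
      have := hzero (t ^ d) (by rw [hn]; exact hapos) (by rw [hn]; exact haR')
        (by rw [hn]; exact hapos) (by rw [hn]; exact haR')
      rwa [e1, e1] at this
    have r2 : MvPolynomial.eval ![1 / Ψ (B * t ^ k₁), 1 / Ψ (q * t ^ k₂)] P = 0 := by
      have hn : ∀ k : ℤ, ‖a * (y0 * t) ^ k‖ = ‖a * y0 ^ k‖ := fun k => by
        rw [mul_zpow, ← mul_assoc, norm_mul, htn, mul_one]
      have hpos : ∀ k : ℤ, 0 < ‖a * y0 ^ k‖ := fun k =>
        norm_pos_iff.2 (mul_ne_zero ha0 (zpow_ne_zero _ hy00))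
      have := hzero (y0 * t) (by rw [hn]; exact hpos _) (by rw [hn]; exact hay1)
        (by rw [hn]; exact hpos _) (by rw [hn]; exact hay2)
      rw [mul_zpow, mul_zpow, hy0, ← mul_assoc, ← mul_assoc, mul_div_cancel₀ _ hA20] at this
      exact this
    have e3 : ∀ (A : 𝕃) (k : ℤ), (A * (t ^ k) ^ d) ^ D = A ^ D * t ^ (k * (d * D : ℕ)) := fun A k => by
      rw [e2, mul_pow]
    have hnr : ∀ L : 𝕃, ∀ k : ℤ, ‖L‖ < r → ‖L * t ^ k‖ < R := fun L k hL => by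
      rw [norm_mul, htn, mul_one]; exact hL.trans_le hrR
    have hV : Transcendental ℚ (Ψ (A2 * (t ^ k₂) ^ d)) := by
      intro hal
      apply hnb
      refine ⟨(htn _).le, ?_⟩
      rw [hφ _ (mul_ne_zero hL30 (htk _)) (hnr _ _ hL3r), one_div, IsAlgebraic.inv_iff, hL3, ← e3]
      have hbot : ∀ x : 𝕃, IsAlgebraic ℚ x → IsAlgebraic (⊥ : IntermediateField ℚ 𝕃) x := fun x hx =>
        hx.extendScalars (algebraMap ℚ (⊥ : IntermediateField ℚ 𝕃)).injective
      have hit := psi_iter f (hd ▸ hdeg) ⊥ (fun i => hbot _ (hfalg i)) R hR1 Ψ (hd ▸ hΨfun)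
        _ hw0 hw (hbot _ hal) n
      rw [hd] at hit
      exact hit.restrictScalars ℚ
    have hres := per_t f (hd ▸ hdeg) hfalg R hR1 Ψ (hd ▸ hΨfun) P hPne hPalg
      (A1 * (t ^ k₁) ^ d) (A2 * (t ^ k₂) ^ d) (B * t ^ k₁) (q * t ^ k₂) hs0 hs hσ0 hσ hω0 hω
      (by rw [hd, mul_pow, hq]) r1 r2 hV n
    rw [hd, pow_succ' d n, pow_mul, mul_pow B, ← hD, e3, e3] at hres
    rw [hφ _ (mul_ne_zero hL10 (htk _)) (hnr _ _ hL1r),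
      hφ _ (mul_ne_zero hL20 (htk _)) (hnr _ _ hL2r)]
    exact hres
  -- pigeonhole over the countably many `Q`
  have hex : ∃ Q : MvPolynomial (Fin 2) ℚ, Q ≠ 0 ∧ ¬ {t : 𝕃 | ‖t‖ = 1 ∧ MvPolynomial.aeval
        ![φ (L1 * t ^ (k₁ * (d * D : ℕ))), φ (L2 * t ^ (k₁ * (d * D : ℕ)))] Q = 0}.Countable := by
    by_contra hcon
    push Not at hcon
    have := countable_mvp
    have hU : (⋃ Q ∈ {Q : MvPolynomial (Fin 2) ℚ | Q ≠ 0}, {t : 𝕃 | ‖t‖ = 1 ∧ MvPolynomial.aeval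
        ![φ (L1 * t ^ (k₁ * (d * D : ℕ))), φ (L2 * t ^ (k₁ * (d * D : ℕ)))] Q = 0}).Countable :=
      (Set.to_countable _).biUnion fun Q hQ => hcon Q hQ
    refine sphere_uncountable ((hbad.union hU).mono ?_)
    intro t ht
    by_cases hb : t ∈ {t : 𝕃 | t ^ (k₂ * (d * D : ℕ)) ∈
      {τ : 𝕃 | ‖τ‖ ≤ 1 ∧ IsAlgebraic ℚ (φ (L3 * τ))}}
    · exact Or.inl hb
    · obtain ⟨Q, hQ, hQ0⟩ := hgood t ht hb
      exact Or.inr (Set.mem_biUnion (show Q ∈ {Q : MvPolynomial (Fin 2) ℚ | Q ≠ 0} from hQ)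
        ⟨ht, hQ0⟩)
  obtain ⟨Q, hQ, hTQ⟩ := hex
  have hGQ := hG1.aeval hG2 Q
  have hall := hGQ.eq_zero (by
    by_contra hfin
    rw [Set.not_infinite] at hfin
    refine hTQ ((countable_zpow_preimage _ hdk1 _ hfin.countable).mono ?_)
    rintro t ⟨ht, hQt⟩
    refine ⟨?_, hQt⟩
    rw [norm_zpow, ht, one_zpow])
  obtain ⟨u1, hu1, hu1'⟩ := hφu L1
  obtain ⟨u2, hu2, hu2'⟩ := hφu L2
  have hlow := lowest Q hQ u1 u2 L1 L2 hL10 hu1 hu2 (by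
    have hb : Metric.ball (0 : 𝕃) 1 ∈ nhdsWithin (0 : 𝕃) {0}ᶜ :=
      mem_nhdsWithin_of_mem_nhds (Metric.ball_mem_nhds _ one_pos)
    filter_upwards [hb] with t ht
    rw [← hu1', ← hu2']
    exact hall t (by simpa using (mem_ball_zero_iff.1 ht).le))
  rw [hL1, hL2, ← div_pow] at hlow
  exact hctr (hlow.of_pow (by omega))

theorem stmt18
    (𝕃 : Type*) [NontriviallyNormedField 𝕃] [IsAlgClosed 𝕃] [CharZero 𝕃] [CompleteSpace 𝕃]
    -- the absolute value of `𝕃` is non-archimedean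
    (hna : IsNonarchimedean (fun x : 𝕃 => ‖x‖))
    (f : Polynomial 𝕃) (hmonic : f.Monic) (hdeg : 2 ≤ f.natDegree)
    (hfalg : ∀ i : ℕ, IsAlgebraic ℚ (f.coeff i))
    (R : ℝ) (hR0 : 0 < R) (hR1 : R ≤ 1)
    (Ψ : 𝕃 → 𝕃)
    -- `Ψ` is analytic on the punctured disc `Δ_R*`
    (hΨan : AnalyticOnNhd 𝕃 Ψ {z : 𝕃 | z ≠ 0 ∧ ‖z‖ < R})
    -- `z·Ψ(z)` extends analytically to `{‖z‖ < R}` with value `1` at `0`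
    (hΨext : ∃ h : 𝕃 → 𝕃, AnalyticOnNhd 𝕃 h (Metric.ball 0 R) ∧ h 0 = 1 ∧
      ∀ z : 𝕃, z ≠ 0 → ‖z‖ < R → z * Ψ z = h z)
    -- `Ψ(z^d) = f(Ψ(z))`
    (hΨfun : ∀ z : 𝕃, z ≠ 0 → ‖z‖ < R → Ψ (z ^ f.natDegree) = f.eval (Ψ z))
    -- `‖Ψ(z)‖ = ‖z‖⁻¹`
    (hΨnorm : ∀ z : 𝕃, z ≠ 0 → ‖z‖ < R → ‖Ψ z‖ = ‖z‖⁻¹)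
    (P : MvPolynomial (Fin 2) 𝕃) (hPne : P ≠ 0) (hP : Irreducible P)
    (hPalg : ∀ m, IsAlgebraic ℚ (MvPolynomial.coeff m P))
    (ζ₁ ζ₂ : 𝕃) (hζ₁ : ∃ n : ℕ, 1 ≤ n ∧ ζ₁ ^ n = 1) (hζ₂ : ∃ n : ℕ, 1 ≤ n ∧ ζ₂ ^ n = 1)
    (k₁ k₂ : ℤ) (hk : (k₁, k₂) ≠ (0, 0))
    (a : 𝕃) (ha : Transcendental ℚ a) (ha0 : 0 < ‖a‖) (haR : ‖a‖ < R ^ f.natDegree)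
    (hzero : ∀ x : 𝕃,
      0 < ‖a * x ^ k₁‖ → ‖a * x ^ k₁‖ < R →
      0 < ‖a * x ^ k₂‖ → ‖a * x ^ k₂‖ < R →
      MvPolynomial.eval ![1 / Ψ (ζ₁ * a * x ^ k₁), 1 / Ψ (ζ₂ * a * x ^ k₂)] P = 0) :
    k₁ * k₂ * (k₁ - k₂) = 0 := by
  by_contra hcon
  have hk1 : k₁ ≠ 0 := by rintro rfl; simp at hcon
  have hk2 : k₂ ≠ 0 := by rintro rfl; simp at hcon
  have hk12 : k₁ ≠ k₂ := by rintro rfl; simp at hcon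
  haveI : IsUltrametricDist 𝕃 :=
    IsUltrametricDist.isUltrametricDist_of_isNonarchimedean_norm hna
  rcases le_total |k₁| |k₂| with hle | hle
  · exact main_le f hdeg hfalg R hR0 hR1 Ψ hΨext hΨfun hΨnorm P hPne hPalg ζ₁ ζ₂ hζ₁ hζ₂
      k₁ k₂ hk1 hk2 hk12 hle a ha haR hzero
  · let e : Fin 2 ≃ Fin 2 := Equiv.swap 0 1
    refine main_le f hdeg hfalg R hR0 hR1 Ψ hΨext hΨfun hΨnorm (MvPolynomial.rename e P) ?_ ?_
      ζ₂ ζ₁ hζ₂ hζ₁ k₂ k₁ hk2 hk1 hk12.symm hle a ha haR ?_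
    · intro h
      exact hPne (MvPolynomial.rename_injective e e.injective (by rw [h, map_zero]))
    · intro m
      have hm : m = (m.mapDomain e.symm).mapDomain e := by
        rw [← Finsupp.mapDomain_comp]; simp
      rw [hm, MvPolynomial.coeff_rename_mapDomain _ e.injective]
      exact hPalg _
    · intro x h1 h2 h3 h4
      rw [MvPolynomial.eval_rename]
      have := hzero x h3 h4 h1 h2
      have hvec : ![1 / Ψ (ζ₂ * a * x ^ k₂), 1 / Ψ (ζ₁ * a * x ^ k₁)] ∘ e =
          ![1 / Ψ (ζ₁ * a * x ^ k₁), 1 / Ψ (ζ₂ * a * x ^ k₂)] := by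
        funext i
        fin_cases i <;> simp [e]
      rw [hvec]
      exact this
end
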